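/- arXiv:2503.10319 — 3 statements merged into one kernel-verified Lean document; each statement's English description precedes it below -/
import Mathlib

section
/- Let μ be a Borel probability measure on [0,∞), let L : (0,∞) → (0,∞) be slowly varying, and let α ∈ (0,1). Then the following are equivalent as t → +∞: (a) μ((t,∞)) ~ L(t)/t^α; (b) −ψ_μ(−1/t) ~ (πα/sin(πα)) · L(t)/t^α, where −ψ_μ(−1/t) = ∫ x/(t+x) dμ(x). -/
open MeasureTheory Filter Topology Real

/-- The moment transform `ψ_μ(z) = ∫ z t / (1 - z t) dμ(t)` of a measure on `ℝ`. -/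
noncomputable def psi (μ : Measure ℝ) (z : ℝ) : ℝ := ∫ t, z * t / (1 - z * t) ∂μ

/-- A function `L : (0,∞) → (0,∞)` is slowly varying if `L(λ t)/L(t) → 1` as `t → ∞`
for every `λ > 0`. -/
def SlowlyVarying (L : ℝ → ℝ) : Prop :=
  ∀ l : ℝ, 0 < l → Tendsto (fun t => L (l * t) / L t) atTop (𝓝 1)

theorem image_div_one_add_Ioi : (fun u : ℝ => u / (1 + u)) '' Set.Ioi 0 = Set.Ioo 0 1 := by
  ext v
  simp only [Set.mem_image, Set.mem_Ioi, Set.mem_Ioo]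
  constructor
  · rintro ⟨u, hu, rfl⟩
    exact ⟨by positivity, by rw [div_lt_one (by positivity)]; linarith⟩
  · rintro ⟨h0, h1⟩
    have : 0 < 1 - v := by linarith
    refine ⟨v / (1 - v), by positivity, ?_⟩
    field_simp
    ring

theorem hasDerivAt_div_one_add {u : ℝ} (hu : 1 + u ≠ 0) :
    HasDerivAt (fun u : ℝ => u / (1 + u)) (1 / (1 + u) ^ 2) u :=
  ((hasDerivAt_id' u).div ((hasDerivAt_id' u).const_add 1) hu).congr_deriv (by ring)

theorem integral_Ioi_rpow_mul_one_add_rpow {a b : ℝ} (ha : 0 < a) (hb : 0 < b) :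
    ∫ u in Set.Ioi (0 : ℝ), u ^ (a - 1) * (1 + u) ^ (-(a + b)) = ProbabilityTheory.beta a b := by
  have hbeta : ProbabilityTheory.beta a b
      = ∫ v in Set.Ioo (0 : ℝ) 1, v ^ (a - 1) * (1 - v) ^ (b - 1) := by
    rw [ProbabilityTheory.beta_eq_betaIntegralReal a b ha hb, Complex.betaIntegral,
      intervalIntegral.integral_of_le zero_le_one, integral_Ioc_eq_integral_Ioo]
    rw [← RCLike.re_eq_complex_re]
    have : ∫ v in Set.Ioo (0 : ℝ) 1, (v : ℂ) ^ ((a : ℂ) - 1) * (1 - (v : ℂ)) ^ ((b : ℂ) - 1)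
        = ∫ v in Set.Ioo (0 : ℝ) 1, ((v ^ (a - 1) * (1 - v) ^ (b - 1) : ℝ) : ℂ) := by
      refine setIntegral_congr_fun measurableSet_Ioo fun v hv => ?_
      simp only [Complex.ofReal_mul]
      rw [Complex.ofReal_cpow hv.1.le, Complex.ofReal_cpow (by linarith [hv.2])]
      push_cast
      rfl
    rw [this, integral_complex_ofReal]
    simp
  have hderiv : ∀ u ∈ Set.Ioi (0 : ℝ), HasDerivWithinAt (fun u : ℝ => u / (1 + u))
      (1 / (1 + u) ^ 2) (Set.Ioi 0) u := by
    intro u hu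
    have hu' : (0 : ℝ) < u := hu
    exact (hasDerivAt_div_one_add (by positivity)).hasDerivWithinAt
  have hinj : Set.InjOn (fun u : ℝ => u / (1 + u)) (Set.Ioi 0) := by
    intro x hx y hy h
    have hx' : (0 : ℝ) < x := hx
    have hy' : (0 : ℝ) < y := hy
    simp only at h
    field_simp at h
    linarith
  rw [hbeta, ← image_div_one_add_Ioi,
    integral_image_eq_integral_abs_deriv_smul measurableSet_Ioi hderiv hinj]
  refine setIntegral_congr_fun measurableSet_Ioi fun u hu => ?_
  have hu' : (0 : ℝ) < u := hu
  have h1 : (0 : ℝ) < 1 + u := by positivity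
  have h2 : 1 - u / (1 + u) = (1 + u)⁻¹ := by field_simp; ring
  simp only [smul_eq_mul]
  rw [h2, abs_of_pos (by positivity), div_rpow hu'.le h1.le, inv_rpow h1.le, one_div,
    ← rpow_natCast, ← rpow_neg h1.le, ← rpow_neg h1.le, div_eq_mul_inv, ← rpow_neg h1.le]
  have : (1 + u) ^ (-(a + b)) = (1 + u) ^ (-((2 : ℕ) : ℝ)) * (1 + u) ^ (-(a - 1))
      * (1 + u) ^ (-(b - 1)) := by
    rw [← rpow_add h1, ← rpow_add h1]
    congr 1
    push_cast
    ring
  rw [this]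
  ring

theorem integrableOn_Ioi_rpow_mul_one_add_rpow {a b : ℝ} (ha : 0 < a) (hb : 0 < b) :
    IntegrableOn (fun u : ℝ => u ^ (a - 1) * (1 + u) ^ (-(a + b))) (Set.Ioi 0) := by
  by_contra h
  have := integral_undef h
  rw [integral_Ioi_rpow_mul_one_add_rpow ha hb] at this
  exact (ProbabilityTheory.beta_pos ha hb).ne' this

theorem beta_one_sub_one_add {α : ℝ} (hα : 0 < α) :
    ProbabilityTheory.beta (1 - α) (1 + α) = π * α / Real.sin (π * α) := by
  rw [ProbabilityTheory.beta, show 1 - α + (1 + α) = 2 by ring, Gamma_two, add_comm 1 α,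
    Real.Gamma_add_one hα.ne', div_one, mul_left_comm, mul_comm (Real.Gamma (1 - α)),
    Real.Gamma_mul_Gamma_one_sub]
  ring

theorem beta_one_sub_self (α : ℝ) :
    ProbabilityTheory.beta (1 - α) α = π / Real.sin (π * α) := by
  rw [ProbabilityTheory.beta, show 1 - α + α = 1 by ring, Gamma_one, div_one,
    mul_comm (Real.Gamma (1 - α)), Real.Gamma_mul_Gamma_one_sub]

/-- A closed subspace of continuous functions on the unit interval containing all the functions
`v ↦ 1 / (1 + c v)` with `c ≥ 0` is the whole space. -/
theorem eq_top_of_resolvents_mem (S : Submodule ℝ C(unitInterval, ℝ))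
    (hS : IsClosed (S : Set C(unitInterval, ℝ)))
    (h : ∀ f : C(unitInterval, ℝ), ∀ c : ℝ, 0 ≤ c →
      (∀ v : unitInterval, f v = 1 / (1 + c * v)) → f ∈ S) :
    S = ⊤ := by
  let X : C(unitInterval, ℝ) := ⟨fun v => v, continuous_subtype_val⟩
  let R : ℝ → C(unitInterval, ℝ) := fun c =>
    ⟨fun v => 1 / (1 + |c| * v), by
      refine continuous_const.div (by fun_prop) fun v => ?_
      have := v.2.1
      positivity⟩
  have key : ∀ k : ℕ, X ^ k ∈ S ∧ ∀ c : ℝ, 0 < c → X ^ k * R c ∈ S := by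
    intro k
    induction k with
    | zero =>
      refine ⟨h _ 0 le_rfl fun v => by simp, fun c hc => h _ c hc.le fun v => ?_⟩
      simp [R, abs_of_pos hc]
    | succ k ih =>
      have hR : ∀ c : ℝ, 0 < c → X ^ (k + 1) * R c ∈ S := by
        intro c hc
        have : X ^ (k + 1) * R c = c⁻¹ • (X ^ k - X ^ k * R c) := by
          ext v
          have := v.2.1
          have h1 : (0 : ℝ) < 1 + c * v := by positivity
          simp only [ContinuousMap.coe_mul, ContinuousMap.coe_pow, Pi.mul_apply, Pi.pow_apply,
            ContinuousMap.coe_mk, abs_of_pos hc, ContinuousMap.coe_smul, ContinuousMap.coe_sub,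
            Pi.smul_apply, Pi.sub_apply, smul_eq_mul, R, X]
          field_simp
          ring
        rw [this]
        exact S.smul_mem _ (S.sub_mem ih.1 (ih.2 c hc))
      refine ⟨?_, hR⟩
      have hlim : Tendsto (fun c : ℝ => X ^ (k + 1) * R c) (𝓝[>] 0) (𝓝 (X ^ (k + 1) * R 0)) := by
        refine Tendsto.mono_left ?_ nhdsWithin_le_nhds
        refine Tendsto.const_mul _ ?_
        refine Continuous.tendsto (f := R) ?_ 0
        refine ContinuousMap.continuous_of_continuous_uncurry _ ?_
        refine continuous_const.div (by fun_prop) fun v => ?_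
        have := v.2.2.1
        positivity
      have h0 : R 0 = 1 := by ext v; simp [R]
      rw [h0, mul_one] at hlim
      exact hS.mem_of_tendsto hlim (eventually_nhdsWithin_of_forall fun c hc => hR c hc)
  rw [eq_top_iff]
  rintro f -
  have hf := continuousMap_mem_polynomialFunctions_closure 0 1 f
  refine closure_minimal ?_ hS hf
  rintro - ⟨p, -, rfl⟩
  simp only [RingHom.coe_coe]
  induction p using Polynomial.induction_on' with
  | add p q hp hq => rw [map_add]; exact S.add_mem hp hq
  | monomial n a =>
    have : Polynomial.toContinuousMapOnAlgHom (Set.Icc (0 : ℝ) 1) (Polynomial.monomial n a)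
        = a • X ^ n := by
      ext v
      simp [X]
    rw [this]
    exact S.smul_mem _ (key n).1

theorem tendsto_of_tendsto_resolvents {ι : Type*} {l : Filter ι}
    (E : ι → C(unitInterval, ℝ) →ₗ[ℝ] ℝ) (E₀ : C(unitInterval, ℝ) →ₗ[ℝ] ℝ)
    (hE : ∀ᶠ t in l, ∀ f, |E t f| ≤ ‖f‖) (hE₀ : ∀ f, |E₀ f| ≤ ‖f‖)
    (h : ∀ f : C(unitInterval, ℝ), ∀ c : ℝ, 0 ≤ c →
      (∀ v : unitInterval, f v = 1 / (1 + c * v)) → Tendsto (fun t => E t f) l (𝓝 (E₀ f)))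
    (f : C(unitInterval, ℝ)) : Tendsto (fun t => E t f) l (𝓝 (E₀ f)) := by
  let S : Submodule ℝ C(unitInterval, ℝ) :=
    { carrier := {f | Tendsto (fun t => E t f) l (𝓝 (E₀ f))}
      add_mem' := fun {f g} hf hg => by
        simpa only [Set.mem_ofPred_eq, map_add] using hf.add hg
      zero_mem' := by simp [tendsto_const_nhds]
      smul_mem' := fun a f hf => by
        simpa only [Set.mem_ofPred_eq, map_smul] using hf.const_smul a }
  have hS : IsClosed (S : Set C(unitInterval, ℝ)) := by
    rw [← isSeqClosed_iff_isClosed]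
    intro g f hg hgf
    refine Metric.tendsto_nhds.2 fun ε hε => ?_
    obtain ⟨n, hn⟩ := (Metric.tendsto_nhds.1 hgf (ε / 3) (by positivity)).exists
    filter_upwards [hE, Metric.tendsto_nhds.1 (hg n) (ε / 3) (by positivity)] with t ht ht'
    rw [dist_eq_norm] at hn
    have h1 := ht (g n - f)
    have h2 := hE₀ (g n - f)
    rw [map_sub] at h1 h2
    rw [Real.dist_eq] at ht' ⊢
    rw [abs_le] at h1 h2
    rw [abs_lt] at ht' ⊢
    constructor <;> linarith [h1.1, h1.2, h2.1, h2.2, ht'.1, ht'.2]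
  have : S = ⊤ := eq_top_of_resolvents_mem S hS fun f c hc hf => h f c hc hf
  have hf : f ∈ S := this ▸ Submodule.mem_top
  exact hf

theorem SlowlyVarying.tendsto_ratio {L F : ℝ → ℝ} (hL : SlowlyVarying L)
    (hLpos : ∀ t : ℝ, 0 < t → 0 < L t) {α k c : ℝ} (hk : 0 < k) (hc : 0 < c)
    (hF : Tendsto (fun t => F t / (k * (L t / t ^ α))) atTop (𝓝 1)) :
    Tendsto (fun t => F (c * t) / F t) atTop (𝓝 (c ^ (-α))) := by
  have hct : Tendsto (fun t : ℝ => c * t) atTop atTop := tendsto_id.const_mul_atTop hc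
  have h := (((hF.comp hct).div hF one_ne_zero).mul (hL c hc)).mul_const (c ^ (-α))
  rw [div_one, one_mul, one_mul] at h
  refine h.congr' ?_
  filter_upwards [eventually_gt_atTop 0] with t ht
  have h1 := hLpos t ht
  have h2 := hLpos (c * t) (by positivity)
  have h3 : 0 < t ^ α := by positivity
  have h4 : 0 < c ^ α := by positivity
  simp only [Function.comp, Pi.div_apply]
  rw [mul_rpow hc.le ht.le, rpow_neg hc.le]
  by_cases hFt : F t = 0
  · simp [hFt]
  · field_simp

theorem Antitone.le_mul_rpow_of_doubling {G : ℝ → ℝ} (hG : Antitone G) (hpos : ∀ t, 0 < G t)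
    {β t₀ : ℝ} (hβ : 0 < β) (ht₀ : 0 < t₀) (h : ∀ s, t₀ ≤ s → G s ≤ 2 ^ β * G (2 * s))
    {s t : ℝ} (hs : t₀ ≤ s) (hst : s ≤ t) : G s ≤ 2 ^ β * (t / s) ^ β * G t := by
  have key : ∀ n : ℕ, ∀ s, t₀ ≤ s → s ≤ t → t < 2 ^ n * s → G s ≤ 2 ^ β * (t / s) ^ β * G t := by
    intro n
    induction n with
    | zero => intro s _ h1 h2; simp at h2; linarith
    | succ n ih =>
      intro s hs hst hn
      have hs0 : 0 < s := by linarith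
      have ht0 : 0 < t := by linarith
      have h2 : (0 : ℝ) < 2 ^ β := by positivity
      rcases le_or_gt (2 * s) t with h2s | h2s
      · have := ih (2 * s) (by linarith) h2s (by rw [pow_succ] at hn; linarith)
        calc G s ≤ 2 ^ β * G (2 * s) := h s hs
          _ ≤ 2 ^ β * (2 ^ β * (t / (2 * s)) ^ β * G t) := by gcongr
          _ = 2 ^ β * ((2 * (t / (2 * s))) ^ β * G t) := by
            rw [mul_rpow (x := 2) (by norm_num) (by positivity)]
          _ = 2 ^ β * (t / s) ^ β * G t := by
            rw [show 2 * (t / (2 * s)) = t / s by field_simp, mul_assoc]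
      · calc G s ≤ 2 ^ β * G (2 * s) := h s hs
          _ ≤ 2 ^ β * 1 * G t := by
            rw [mul_one]
            exact mul_le_mul_of_nonneg_left (hG h2s.le) h2.le
          _ ≤ 2 ^ β * (t / s) ^ β * G t := by
            have := (hpos t).le
            gcongr
            exact one_le_rpow ((one_le_div hs0).2 hst) hβ.le
  have hs0 : 0 < s := by linarith
  obtain ⟨n, hn⟩ := pow_unbounded_of_one_lt (t / s) (one_lt_two (α := ℝ))
  exact key n s hs hst ((div_lt_iff₀ hs0).1 hn)

theorem Antitone.exists_potter_bound {G : ℝ → ℝ} (hG : Antitone G) (hpos : ∀ t, 0 < G t)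
    (hle : ∀ t, G t ≤ 1) {α β : ℝ} (hα : 0 < α) (hαβ : α < β)
    (h : Tendsto (fun t => G (2 * t) / G t) atTop (𝓝 (2 ^ (-α)))) :
    ∃ C t₀ : ℝ, 0 < t₀ ∧ ∀ t, t₀ ≤ t → ∀ u, 0 < u → u ≤ 1 → G (t * u) / G t ≤ C * u ^ (-β) := by
  have hβ : 0 < β := hα.trans hαβ
  have hlt : (2 : ℝ) ^ (-β) < 2 ^ (-α) := rpow_lt_rpow_of_exponent_lt one_lt_two (by linarith)
  obtain ⟨t₀, ht₀, hbd⟩ : ∃ t₀ : ℝ, 0 < t₀ ∧ ∀ s, t₀ ≤ s → G s ≤ 2 ^ β * G (2 * s) := by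
    obtain ⟨t₁, h₁⟩ := eventually_atTop.1 (h.eventually_const_lt hlt)
    refine ⟨max t₁ 1, by positivity, fun s hs => ?_⟩
    have := h₁ s (le_trans (le_max_left _ _) hs)
    rw [lt_div_iff₀ (hpos s), rpow_neg zero_le_two, inv_mul_lt_iff₀ (by positivity)] at this
    exact this.le
  refine ⟨2 ^ β / G t₀, t₀, ht₀, fun t ht u hu hu1 => ?_⟩
  have ht0 : 0 < t := by linarith
  have hGt := hpos t
  have hG0 := hpos t₀
  rw [div_le_iff₀ hGt]
  have hrw : (t / (t * u)) ^ β = u ^ (-β) := by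
    rw [rpow_neg hu.le, ← inv_rpow hu.le]
    congr 1
    field_simp
  rcases le_or_gt t₀ (t * u) with hs | hs
  · have h1 := hG.le_mul_rpow_of_doubling hpos hβ ht₀ hbd hs
      (mul_le_of_le_one_right ht0.le hu1)
    rw [hrw] at h1
    refine h1.trans ?_
    gcongr
    rw [le_div_iff₀ hG0]
    exact mul_le_of_le_one_right (by positivity) (hle t₀)
  · have h1 := hG.le_mul_rpow_of_doubling hpos hβ ht₀ hbd le_rfl ht
    have h2 : (t / t₀) ^ β ≤ u ^ (-β) := by
      rw [← hrw]
      gcongr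
    calc G (t * u) ≤ 1 := hle _
      _ = G t₀ / G t₀ := (div_self hG0.ne').symm
      _ ≤ (2 ^ β * (t / t₀) ^ β * G t) / G t₀ := by gcongr
      _ ≤ (2 ^ β * u ^ (-β) * G t) / G t₀ := by gcongr
      _ = 2 ^ β / G t₀ * u ^ (-β) * G t := by ring

theorem Antitone.tendsto_integral_ratio {G : ℝ → ℝ} (hG : Antitone G) (hpos : ∀ t, 0 < G t)
    (hle : ∀ t, G t ≤ 1) {α : ℝ} (hα : α ∈ Set.Ioo (0 : ℝ) 1)
    (h : ∀ c : ℝ, 0 < c → Tendsto (fun t => G (c * t) / G t) atTop (𝓝 (c ^ (-α)))) :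
    Tendsto (fun t => ∫ u in Set.Ioi (0 : ℝ), G (t * u) / G t * (1 + u) ^ (-2 : ℝ)) atTop
      (𝓝 (∫ u in Set.Ioi (0 : ℝ), u ^ (-α) * (1 + u) ^ (-2 : ℝ))) := by
  obtain ⟨hα0, hα1⟩ := hα
  obtain ⟨β, hαβ, hβ1⟩ := exists_between hα1
  obtain ⟨C, t₀, ht₀, hbd⟩ := hG.exists_potter_bound hpos hle hα0 hαβ (h 2 two_pos)
  have hmeas := hG.measurable
  refine tendsto_integral_filter_of_dominated_convergence
    (fun u => C * (u ^ (-β) * (1 + u) ^ (-2 : ℝ)) + (1 + u) ^ (-2 : ℝ)) ?_ ?_ ?_ ?_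
  · exact Eventually.of_forall fun t => by fun_prop
  · filter_upwards [eventually_ge_atTop t₀] with t ht
    refine (ae_restrict_iff' measurableSet_Ioi).2 (ae_of_all _ fun u hu => ?_)
    have hu : 0 < u := hu
    have ht0 : 0 < t := by linarith
    have h1 := hpos (t * u)
    have h2 := hpos t
    have hC : 0 ≤ C := by
      have := hbd t ht 1 one_pos le_rfl
      rw [one_rpow, mul_one, mul_one] at this
      exact (div_nonneg h2.le h2.le).trans this
    rw [Real.norm_of_nonneg (by positivity), ← mul_assoc, ← add_one_mul]
    gcongr
    rcases le_or_gt u 1 with hu1 | hu1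
    · linarith [hbd t ht u hu hu1]
    · have : G (t * u) / G t ≤ 1 := (div_le_one h2).2 (hG (by nlinarith))
      have : 0 ≤ C * u ^ (-β) := by positivity
      linarith
  · refine Integrable.add (Integrable.const_mul ?_ C) ?_
    · have := integrableOn_Ioi_rpow_mul_one_add_rpow (a := 1 - β) (b := 1 + β) (by linarith)
        (by linarith)
      rwa [show 1 - β - 1 = -β by ring, show -(1 - β + (1 + β)) = (-2 : ℝ) by ring] at this
    · have := integrableOn_Ioi_rpow_mul_one_add_rpow (a := 1) (b := 1) one_pos one_pos
      simp only [sub_self, rpow_zero, one_mul, one_add_one_eq_two] at this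
      exact this
  · refine (ae_restrict_iff' measurableSet_Ioi).2 (ae_of_all _ fun u hu => ?_)
    simpa only [mul_comm] using (h u hu).mul_const ((1 + u) ^ (-2 : ℝ))

theorem integral_one_add_rpow_neg_two {y : ℝ} (hy : 0 ≤ y) :
    ∫ u in (0 : ℝ)..y, (1 + u) ^ (-2 : ℝ) = y / (1 + y) := by
  have hpos : ∀ u ∈ Set.uIcc 0 y, 0 < 1 + u := fun u hu => by
    rw [Set.uIcc_of_le hy] at hu
    linarith [hu.1]
  rw [intervalIntegral.integral_eq_sub_of_hasDerivAt (f := fun u => u / (1 + u))]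
  · simp
  · intro u hu
    have := hpos u hu
    refine (hasDerivAt_div_one_add this.ne').congr_deriv ?_
    rw [rpow_neg this.le, rpow_two, one_div]
  · refine ContinuousOn.intervalIntegrable fun u hu => ContinuousAt.continuousWithinAt ?_
    exact ContinuousAt.rpow_const (by fun_prop) (Or.inl (hpos u hu).ne')

theorem ae_nonneg_of_measure_Iio {μ : Measure ℝ} (hsupp : μ (Set.Iio 0) = 0) : ∀ᵐ x ∂μ, 0 ≤ x := by
  rw [ae_iff]
  simpa [Set.Iio] using hsupp

theorem integral_div_add_eq_integral_tail (μ : Measure ℝ) [IsProbabilityMeasure μ]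
    (hsupp : μ (Set.Iio 0) = 0) {t : ℝ} (ht : 0 < t) :
    ∫ x, x / (t + x) ∂μ
      = ∫ u in Set.Ioi (0 : ℝ), (μ (Set.Ioi (t * u))).toReal * (1 + u) ^ (-2 : ℝ) := by
  have hae := ae_nonneg_of_measure_Iio hsupp
  have hnn : 0 ≤ᵐ[μ] fun x => x / t := hae.mono fun x hx => div_nonneg hx ht.le
  have hlc := lintegral_comp_eq_lintegral_meas_lt_mul μ (f := fun x => x / t)
    (g := fun u => (1 + u) ^ (-2 : ℝ)) hnn (by fun_prop) (fun y hy => by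
      refine ContinuousOn.intervalIntegrable fun u hu => ContinuousAt.continuousWithinAt ?_
      rw [Set.uIcc_of_le hy.le] at hu
      exact ContinuousAt.rpow_const (by fun_prop) (Or.inl (by linarith [hu.1])))
    ((ae_restrict_iff' measurableSet_Ioi).2 (ae_of_all _ fun u hu => by
      have : (0 : ℝ) < u := hu
      positivity))
  have hmeas : Measurable fun u : ℝ => (μ (Set.Ioi (t * u))).toReal := by
    refine Antitone.measurable fun u v huv => ?_
    refine ENNReal.toReal_mono (measure_ne_top _ _) (measure_mono (Set.Ioi_subset_Ioi ?_))
    gcongr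
  rw [integral_eq_lintegral_of_nonneg_ae (hae.mono fun x hx => by positivity)
      (Measurable.aestronglyMeasurable (by fun_prop)),
    integral_eq_lintegral_of_nonneg_ae ((ae_restrict_iff' measurableSet_Ioi).2
      (ae_of_all _ fun u hu => by
        have : (0 : ℝ) < u := hu
        simp only [Pi.zero_apply]
        positivity))
      (Measurable.aestronglyMeasurable (by fun_prop))]
  congr 1
  calc ∫⁻ x, ENNReal.ofReal (x / (t + x)) ∂μ
      = ∫⁻ x, ENNReal.ofReal (∫ u in (0 : ℝ)..x / t, (1 + u) ^ (-2 : ℝ)) ∂μ := by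
        refine lintegral_congr_ae (hae.mono fun x hx => ?_)
        simp only
        rw [integral_one_add_rpow_neg_two (by positivity)]
        congr 1
        have : 0 < t + x := by linarith
        field_simp
    _ = _ := by
        rw [hlc]
        refine setLIntegral_congr_fun measurableSet_Ioi fun u hu => ?_
        rw [ENNReal.ofReal_mul ENNReal.toReal_nonneg, ENNReal.ofReal_toReal (measure_ne_top _ _)]
        congr 2
        ext x
        simp [lt_div_iff₀ ht, mul_comm]

theorem Integrable.continuousMap_comp_mul {Ω : Type*} [MeasurableSpace Ω] {m : Measure Ω}
    {V : Ω → unitInterval} {W : Ω → ℝ} (hV : Measurable V) (hW : Integrable W m)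
    (f : C(unitInterval, ℝ)) : Integrable (fun x => f (V x) * W x) m :=
  hW.bdd_mul (c := ‖f‖) (f.continuous.measurable.comp hV).aestronglyMeasurable
    (ae_of_all _ fun x => f.norm_coe_le_norm (V x))

/-- The functional `f ↦ ∫ f(V x) W(x) dm(x)` on continuous functions on the unit interval. -/
noncomputable def weightedIntegral {Ω : Type*} [MeasurableSpace Ω] (m : Measure Ω)
    {V : Ω → unitInterval} {W : Ω → ℝ} (hV : Measurable V) (hW : Integrable W m) :
    C(unitInterval, ℝ) →ₗ[ℝ] ℝ where
  toFun f := ∫ x, f (V x) * W x ∂m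
  map_add' f g := by
    simp only [ContinuousMap.add_apply, add_mul]
    exact integral_add (Integrable.continuousMap_comp_mul hV hW f)
      (Integrable.continuousMap_comp_mul hV hW g)
  map_smul' c f := by
    simp only [ContinuousMap.smul_apply, smul_eq_mul, mul_assoc, RingHom.id_apply]
    exact integral_const_mul _ _

theorem weightedIntegral_apply {Ω : Type*} [MeasurableSpace Ω] (m : Measure Ω)
    {V : Ω → unitInterval} {W : Ω → ℝ} (hV : Measurable V) (hW : Integrable W m)
    (f : C(unitInterval, ℝ)) : weightedIntegral m hV hW f = ∫ x, f (V x) * W x ∂m := rfl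

theorem abs_weightedIntegral_le {Ω : Type*} [MeasurableSpace Ω] (m : Measure Ω)
    {V : Ω → unitInterval} {W : Ω → ℝ} (hV : Measurable V) (hW : Integrable W m)
    (hnn : 0 ≤ᵐ[m] W) (h1 : ∫ x, W x ∂m = 1) (f : C(unitInterval, ℝ)) :
    |weightedIntegral m hV hW f| ≤ ‖f‖ := by
  rw [weightedIntegral_apply]
  calc |∫ x, f (V x) * W x ∂m| ≤ ∫ x, ‖f‖ * W x ∂m := by
        refine norm_integral_le_of_norm_le (G := ℝ) (hW.const_mul _) (hnn.mono fun x hx => ?_)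
        rw [norm_mul, Real.norm_of_nonneg hx]
        exact mul_le_mul_of_nonneg_right (f.norm_coe_le_norm _) hx
    _ = ‖f‖ := by rw [integral_const_mul, h1, mul_one]

/-- A continuous function on the unit interval which, in the variable `x = 1/v - 1`, lies between
`1/(1-v)` times the indicator functions of `x ≥ b` and of `x > a`. -/
theorem exists_continuousMap_between {a b : ℝ} (ha : 0 < a) (hab : a < b) :
    ∃ f : C(unitInterval, ℝ), (∀ v, 0 ≤ f v) ∧ (∀ v, f v * (1 - v) ≤ 1) ∧
      (∀ v : unitInterval, (v : ℝ) * (1 + b) ≤ 1 → f v * (1 - v) = 1) ∧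
      (∀ v : unitInterval, 1 ≤ (v : ℝ) * (1 + a) → f v = 0) := by
  have hb : 0 < b := ha.trans hab
  have hq : 0 < a / (1 + a) := by positivity
  have hpq : 0 < 1 / (1 + a) - 1 / (1 + b) := by
    rw [sub_pos]
    gcongr
  have hle : ∀ v : unitInterval, 0 ≤ 1 - (v : ℝ) := fun v => sub_nonneg.2 v.2.2
  have hmax : ∀ v : unitInterval, 0 < max (1 - (v : ℝ)) (a / (1 + a)) := fun v =>
    lt_max_of_lt_right hq
  let f : C(unitInterval, ℝ) :=
    ⟨fun v => max 0 (min 1 ((1 / (1 + a) - v) / (1 / (1 + a) - 1 / (1 + b))))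
      / max (1 - (v : ℝ)) (a / (1 + a)), by
      refine Continuous.div ?_ (by fun_prop) fun v => (hmax v).ne'
      fun_prop⟩
  refine ⟨f, fun v => div_nonneg (le_max_left _ _) (hmax v).le, fun v => ?_, fun v hv => ?_,
    fun v hv => ?_⟩
  · simp only [f, ContinuousMap.coe_mk]
    rw [div_mul_eq_mul_div, div_le_one (hmax v)]
    refine (mul_le_of_le_one_left (hle v) ?_).trans (le_max_left _ _)
    exact max_le zero_le_one (min_le_left _ _)
  · simp only [f, ContinuousMap.coe_mk]
    have h1 : (v : ℝ) ≤ 1 / (1 + b) := (le_div_iff₀ (by positivity)).2 hv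
    have h2 : a / (1 + a) ≤ 1 - v := by
      have : a / (1 + a) = 1 - 1 / (1 + a) := by field_simp; ring
      linarith
    rw [max_eq_left h2, min_eq_left, max_eq_right zero_le_one]
    · rw [one_div, inv_mul_cancel₀ (by linarith)]
    · rw [le_div_iff₀ hpq]
      linarith
  · simp only [f, ContinuousMap.coe_mk]
    have h1 : 1 / (1 + a) ≤ v := (div_le_iff₀ (by positivity)).2 hv
    rw [max_eq_left, zero_div]
    refine (min_le_right _ _).trans (div_nonpos_of_nonpos_of_nonneg (by linarith) hpq.le)

theorem measurable_projIcc_div_add (t : ℝ) :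
    Measurable fun x : ℝ => Set.projIcc (0 : ℝ) 1 zero_le_one (t / (t + x)) :=
  continuous_projIcc.measurable.comp (by fun_prop)

theorem coe_projIcc_div_add {t x : ℝ} (ht : 0 < t) (hx : 0 ≤ x) :
    (Set.projIcc (0 : ℝ) 1 zero_le_one (t / (t + x)) : ℝ) = t / (t + x) := by
  have : 0 < t + x := by linarith
  rw [Set.projIcc_of_mem zero_le_one ⟨by positivity, by rw [div_le_one this]; linarith⟩]

theorem integrable_abs_div_add (μ : Measure ℝ) [IsProbabilityMeasure μ] (t h : ℝ) :
    Integrable (fun x => |x| / (|t| + |x|) / h) μ := by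
  refine Integrable.div_const (Integrable.of_bound (C := 1)
    (Measurable.aestronglyMeasurable (by fun_prop)) (ae_of_all _ fun x => ?_)) h
  rw [Real.norm_of_nonneg (by positivity)]
  exact div_le_one_of_le₀ (by linarith [abs_nonneg t]) (by positivity)

theorem integrableOn_stable_weight {α : ℝ} (hα : α ∈ Set.Ioo (0 : ℝ) 1) (k : ℝ) :
    IntegrableOn (fun x : ℝ => k * (x ^ (-α) / (1 + x))) (Set.Ioi 0) := by
  refine Integrable.const_mul ?_ k
  have h := integrableOn_Ioi_rpow_mul_one_add_rpow (a := 1 - α) (b := α) (by linarith [hα.2]) hα.1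
  rw [show 1 - α - 1 = -α by ring, show -(1 - α + α) = (-1 : ℝ) by ring] at h
  refine h.congr_fun (fun x hx => ?_) measurableSet_Ioi
  simp only [rpow_neg_one, div_eq_mul_inv]

theorem integral_Ioi_rpow_neg_div_add {α : ℝ} (hα : α ∈ Set.Ioo (0 : ℝ) 1) {c : ℝ} (hc : 0 < c) :
    ∫ x in Set.Ioi (0 : ℝ), x ^ (-α) / (c + x) = c ^ (-α) * (π / Real.sin (π * α)) := by
  have h1 : ∫ x in Set.Ioi (0 : ℝ), x ^ (-α) / (1 + x) = π / Real.sin (π * α) := by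
    rw [← beta_one_sub_self, ← integral_Ioi_rpow_mul_one_add_rpow (by linarith [hα.2]) hα.1]
    refine setIntegral_congr_fun measurableSet_Ioi fun x hx => ?_
    rw [show 1 - α - 1 = -α by ring, show -(1 - α + α) = (-1 : ℝ) by ring, rpow_neg_one,
      div_eq_mul_inv]
  have h2 := integral_comp_mul_left_Ioi' (fun x : ℝ => x ^ (-α) / (c + x)) 0 hc
  rw [mul_zero] at h2
  rw [← h2, ← h1, smul_eq_mul, ← integral_const_mul, ← integral_const_mul]
  refine setIntegral_congr_fun measurableSet_Ioi fun x hx => ?_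
  have : (0 : ℝ) < x := hx
  rw [mul_rpow hc.le this.le]
  field_simp

theorem tendsto_tail_div_of_tendsto_ratio {μ : Measure ℝ} [IsProbabilityMeasure μ]
    (hsupp : μ (Set.Iio 0) = 0) {H : ℝ → ℝ}
    (hH : ∀ t, 0 < t → H t = ∫ x, x / (t + x) ∂μ) (hpos : ∀ᶠ t in atTop, 0 < H t)
    {α : ℝ} (hα : α ∈ Set.Ioo (0 : ℝ) 1)
    (h : ∀ c : ℝ, 0 < c → Tendsto (fun t => H (c * t) / H t) atTop (𝓝 (c ^ (-α)))) :
    Tendsto (fun t => (μ (Set.Ioi t)).toReal / H t) atTop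
      (𝓝 ((π * α / Real.sin (π * α))⁻¹)) := by
  have hae := ae_nonneg_of_measure_Iio hsupp
  obtain ⟨hα0, hα1⟩ := id hα
  have hsin : 0 < Real.sin (π * α) :=
    Real.sin_pos_of_pos_of_lt_pi (by positivity) (mul_lt_of_lt_one_right pi_pos hα1)
  set K := π * α / Real.sin (π * α) with hK
  have hKpos : 0 < K := by positivity
  have hKinv : α / K * (π / Real.sin (π * α)) = 1 := by
    rw [div_mul_div_comm, mul_comm α π, hK, div_mul_cancel₀ _ hsin.ne', div_self (by positivity)]
  let E : ℝ → C(unitInterval, ℝ) →ₗ[ℝ] ℝ := fun t =>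
    weightedIntegral μ (measurable_projIcc_div_add t) (integrable_abs_div_add μ t (H t))
  let E₀ : C(unitInterval, ℝ) →ₗ[ℝ] ℝ :=
    weightedIntegral _ (measurable_projIcc_div_add 1) (integrableOn_stable_weight hα (α / K))
  have hW : ∀ t, 0 < t → ∀ x, 0 ≤ x → |x| / (|t| + |x|) / H t = x / (t + x) / H t :=
    fun t ht x hx => by rw [abs_of_pos ht, abs_of_nonneg hx]
  have hE : ∀ᶠ t in atTop, ∀ f, |E t f| ≤ ‖f‖ := by
    filter_upwards [hpos, eventually_gt_atTop 0] with t ht ht0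
    refine abs_weightedIntegral_le _ _ _ (ae_of_all _ fun x => by
      simp only [Pi.zero_apply]
      positivity) ?_
    rw [integral_congr_ae (hae.mono (hW t ht0)), integral_div, ← hH t ht0, div_self ht.ne']
  have hE₀ : ∀ f, |E₀ f| ≤ ‖f‖ := by
    refine abs_weightedIntegral_le _ _ _ ((ae_restrict_iff' measurableSet_Ioi).2
      (ae_of_all _ fun x hx => ?_)) ?_
    · have : (0 : ℝ) < x := hx
      simp only [Pi.zero_apply]
      positivity
    · rw [integral_const_mul, integral_Ioi_rpow_neg_div_add hα one_pos, one_rpow, one_mul, hKinv]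
  have hlim : ∀ f, Tendsto (fun t => E t f) atTop (𝓝 (E₀ f)) := by
    refine fun f => tendsto_of_tendsto_resolvents E E₀ hE hE₀ (fun f c hc hf => ?_) f
    have hc1 : 0 < 1 + c := by linarith
    have h₀ : E₀ f = (1 + c) ^ (-α) := by
      calc E₀ f = ∫ x in Set.Ioi (0 : ℝ), α / K * (x ^ (-α) / ((1 + c) + x)) := by
            refine setIntegral_congr_fun measurableSet_Ioi fun x hx => ?_
            have : (0 : ℝ) < x := hx
            simp only
            rw [hf, coe_projIcc_div_add one_pos this.le]
            field_simp
            ring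
        _ = (1 + c) ^ (-α) := by
            rw [integral_const_mul, integral_Ioi_rpow_neg_div_add hα hc1, mul_left_comm, hKinv,
              mul_one]
    rw [h₀]
    refine (h (1 + c) hc1).congr' ?_
    filter_upwards [eventually_gt_atTop 0] with t ht
    rw [hH ((1 + c) * t) (by positivity), ← integral_div]
    refine integral_congr_ae (hae.mono fun x hx => ?_)
    simp only
    rw [hf, coe_projIcc_div_add ht hx, hW t ht x hx]
    have : 0 < t + x := by linarith
    field_simp
    ring
  have hbetween : ∀ a b : ℝ, 0 < a → a < b → ∃ y : ℝ, b ^ (-α) / K ≤ y ∧ y ≤ a ^ (-α) / K ∧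
      ∃ e : ℝ → ℝ, Tendsto e atTop (𝓝 y) ∧ ∀ᶠ t in atTop,
        (μ (Set.Ioi (b * t))).toReal / H t ≤ e t ∧ e t ≤ (μ (Set.Ioi (a * t))).toReal / H t := by
    intro a b ha hab
    have hb : 0 < b := ha.trans hab
    obtain ⟨f, hf0, hf1, hfb, hfa⟩ := exists_continuousMap_between ha hab
    have hV : ∀ t x, 0 < t → 0 ≤ x →
        let v := Set.projIcc (0 : ℝ) 1 zero_le_one (t / (t + x))
        f v * (x / (t + x)) ≤ 1 ∧ (b * t < x → f v * (x / (t + x)) = 1) ∧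
          (x ≤ a * t → f v = 0) := by
      intro t x ht hx v
      have hv : (v : ℝ) = t / (t + x) := coe_projIcc_div_add ht hx
      have htx : 0 < t + x := by linarith
      have hv1 : x / (t + x) = 1 - (v : ℝ) := by
        rw [hv]
        field_simp
        ring
      rw [hv1]
      refine ⟨hf1 v, fun hx => hfb v ?_, fun hx => hfa v ?_⟩
      · rw [hv, div_mul_eq_mul_div, div_le_one htx]
        linarith
      · rw [hv, div_mul_eq_mul_div, one_le_div htx]
        linarith
    have hw₀ : ∀ x : ℝ, 0 < x → ∀ y : ℝ, y * (α / K * (x ^ (-α) / (1 + x)))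
        = y * (x / (1 + x)) * (α / K * x ^ (-α - 1)) := fun x hx y => by
      rw [rpow_sub_one hx.ne']
      field_simp
    have htail : ∀ d : ℝ, 0 < d → IntegrableOn (fun x : ℝ => α / K * x ^ (-α - 1)) (Set.Ioi d) ∧
        ∫ x in Set.Ioi (0 : ℝ), (Set.Ioi d).indicator (fun x => α / K * x ^ (-α - 1)) x
          = d ^ (-α) / K := by
      intro d hd
      refine ⟨(integrableOn_Ioi_rpow_of_lt (by linarith) hd).const_mul _, ?_⟩
      rw [setIntegral_indicator measurableSet_Ioi,
        Set.inter_eq_right.2 (Set.Ioi_subset_Ioi hd.le), integral_const_mul,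
        integral_Ioi_rpow_of_lt (by linarith) hd, sub_add_cancel]
      field_simp
    have hind : ∀ d : ℝ, 0 < d → Integrable
        ((Set.Ioi d).indicator (fun x : ℝ => α / K * x ^ (-α - 1)))
        (volume.restrict (Set.Ioi 0)) := fun d hd =>
      ((integrable_indicator_iff measurableSet_Ioi).2 (htail d hd).1).restrict
    have hint₀ := Integrable.continuousMap_comp_mul (measurable_projIcc_div_add 1)
      (integrableOn_stable_weight hα (α / K)) f
    refine ⟨E₀ f, ?_, ?_, fun t => E t f, hlim f, ?_⟩
    · rw [← (htail b hb).2]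
      refine setIntegral_mono_on (hind b hb) hint₀ measurableSet_Ioi fun x hx => ?_
      have hx : (0 : ℝ) < x := hx
      obtain ⟨h1, h2, h3⟩ := hV 1 x one_pos hx.le
      rw [mul_one] at h2 h3
      rw [hw₀ x hx]
      by_cases hxb : x ∈ Set.Ioi b
      · rw [Set.indicator_of_mem hxb, h2 hxb, one_mul]
      · rw [Set.indicator_of_notMem hxb]
        have := hf0 (Set.projIcc (0 : ℝ) 1 zero_le_one (1 / (1 + x)))
        positivity
    · rw [← (htail a ha).2]
      refine setIntegral_mono_on hint₀ (hind a ha) measurableSet_Ioi fun x hx => ?_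
      have hx : (0 : ℝ) < x := hx
      obtain ⟨h1, h2, h3⟩ := hV 1 x one_pos hx.le
      rw [mul_one] at h2 h3
      rw [hw₀ x hx]
      by_cases hxa : x ∈ Set.Ioi a
      · rw [Set.indicator_of_mem hxa]
        exact mul_le_of_le_one_left (by positivity) h1
      · rw [Set.indicator_of_notMem hxa, h3 (not_lt.1 hxa), zero_mul, zero_mul]
    · filter_upwards [hpos, eventually_gt_atTop 0] with t ht ht0
      have hG : ∀ s, (μ (Set.Ioi s)).toReal / H t
          = ∫ x, (Set.Ioi s).indicator (fun _ => (H t)⁻¹) x ∂μ := fun s => by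
        rw [integral_indicator_const _ measurableSet_Ioi, smul_eq_mul, div_eq_mul_inv]
        rfl
      have hindμ : ∀ s, Integrable ((Set.Ioi s).indicator (fun _ => (H t)⁻¹)) μ := fun s =>
        (integrable_const _).indicator measurableSet_Ioi
      have hint := Integrable.continuousMap_comp_mul (measurable_projIcc_div_add t)
        (integrable_abs_div_add μ t (H t)) f
      rw [hG, hG]
      refine ⟨integral_mono_ae (hindμ _) hint (hae.mono fun x hx => ?_),
        integral_mono_ae hint (hindμ _) (hae.mono fun x hx => ?_)⟩
      · obtain ⟨h1, h2, h3⟩ := hV t x ht0 hx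
        have htx : 0 < t + x := by linarith
        simp only
        rw [hW t ht0 x hx, ← mul_div_assoc, div_eq_mul_inv _ (H t)]
        by_cases hxb : x ∈ Set.Ioi (b * t)
        · rw [Set.indicator_of_mem hxb, h2 hxb, one_mul]
        · rw [Set.indicator_of_notMem hxb]
          have := hf0 (Set.projIcc (0 : ℝ) 1 zero_le_one (t / (t + x)))
          positivity
      · obtain ⟨h1, h2, h3⟩ := hV t x ht0 hx
        have htx : 0 < t + x := by linarith
        simp only
        rw [hW t ht0 x hx, ← mul_div_assoc, div_eq_mul_inv _ (H t)]
        by_cases hxa : x ∈ Set.Ioi (a * t)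
        · rw [Set.indicator_of_mem hxa]
          exact mul_le_of_le_one_left (by positivity) h1
        · rw [Set.indicator_of_notMem hxa, h3 (not_lt.1 hxa), zero_mul, zero_mul]
  have hone : Tendsto (fun d : ℝ => d ^ (-α) / K) (𝓝 1) (𝓝 K⁻¹) := by
    have : ContinuousAt (fun d : ℝ => d ^ (-α) / K) 1 :=
      (ContinuousAt.rpow_const continuousAt_id (Or.inl one_ne_zero)).div_const K
    simpa [ContinuousAt, one_div] using this
  refine tendsto_order.2 ⟨fun y hy => ?_, fun y hy => ?_⟩
  · obtain ⟨b, hb, hb1⟩ := (((hone.mono_left nhdsWithin_le_nhds).eventually_const_lt hy).and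
      (self_mem_nhdsWithin (s := Set.Ioi (1 : ℝ)))).exists
    obtain ⟨z, hz, -, e, he, hev⟩ := hbetween 1 b one_pos hb1
    filter_upwards [he.eventually_const_lt (hb.trans_le hz), hev] with t h1 h2
    rw [one_mul] at h2
    exact h1.trans_le h2.2
  · obtain ⟨a, ⟨ha, ha1⟩, ha0⟩ :=
      ((((hone.mono_left nhdsWithin_le_nhds).eventually_lt_const hy).and
      (self_mem_nhdsWithin (s := Set.Iio (1 : ℝ)))).and
      (nhdsWithin_le_nhds (eventually_gt_nhds one_pos))).exists
    obtain ⟨z, -, hz, e, he, hev⟩ := hbetween a 1 ha0 ha1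
    filter_upwards [he.eventually_lt_const (hz.trans_lt ha), hev] with t h1 h2
    rw [one_mul] at h2
    exact h2.1.trans_lt h1

theorem neg_psi_neg_one_div (μ : Measure ℝ) {t : ℝ} (ht : 0 < t) :
    -psi μ (-1 / t) = ∫ x, x / (t + x) ∂μ := by
  rw [psi, ← integral_neg]
  congr 1
  ext x
  rw [← mul_div_mul_left _ _ ht.ne', show t * (1 - -1 / t * x) = t + x by field_simp; ring,
    ← neg_div]
  congr 1
  field_simp

theorem tendsto_integral_div_tail_of_tendsto_ratio {μ : Measure ℝ} [IsProbabilityMeasure μ]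
    (hsupp : μ (Set.Iio 0) = 0) (hpos : ∀ᶠ t in atTop, 0 < (μ (Set.Ioi t)).toReal)
    {α : ℝ} (hα : α ∈ Set.Ioo (0 : ℝ) 1)
    (h : ∀ c : ℝ, 0 < c → Tendsto
      (fun t => (μ (Set.Ioi (c * t))).toReal / (μ (Set.Ioi t)).toReal) atTop (𝓝 (c ^ (-α)))) :
    Tendsto (fun t => (∫ x, x / (t + x) ∂μ) / (μ (Set.Ioi t)).toReal) atTop
      (𝓝 (π * α / Real.sin (π * α))) := by
  have hanti : Antitone fun t => (μ (Set.Ioi t)).toReal := fun s t hst =>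
    ENNReal.toReal_mono (measure_ne_top _ _) (measure_mono (Set.Ioi_subset_Ioi hst))
  have hpos' : ∀ t, 0 < (μ (Set.Ioi t)).toReal := fun t => by
    obtain ⟨s, hs, hst⟩ := (hpos.and (eventually_ge_atTop t)).exists
    exact hs.trans_le (hanti hst)
  have hle : ∀ t, (μ (Set.Ioi t)).toReal ≤ 1 := fun t => measureReal_le_one
  have hlim := hanti.tendsto_integral_ratio hpos' hle hα h
  have hK : ∫ u in Set.Ioi (0 : ℝ), u ^ (-α) * (1 + u) ^ (-2 : ℝ)
      = π * α / Real.sin (π * α) := by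
    rw [← beta_one_sub_one_add hα.1,
      ← integral_Ioi_rpow_mul_one_add_rpow (by linarith [hα.2]) (by linarith [hα.1])]
    rw [show 1 - α - 1 = -α by ring, show -(1 - α + (1 + α)) = (-2 : ℝ) by ring]
  rw [hK] at hlim
  refine hlim.congr' ?_
  filter_upwards [eventually_gt_atTop 0] with t ht
  rw [integral_div_add_eq_integral_tail μ hsupp ht, ← integral_div]
  congr 1
  ext u
  ring

theorem eventually_pos_of_tendsto_div {F D : ℝ → ℝ} (hD : ∀ t, 0 < t → 0 < D t)
    (h : Tendsto (fun t => F t / D t) atTop (𝓝 1)) : ∀ᶠ t in atTop, 0 < F t := by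
  filter_upwards [h.eventually_const_lt one_pos, eventually_gt_atTop 0] with t h1 h2
  exact (div_pos_iff_of_pos_right (hD t h2)).1 h1

/-- Tauberian theorem for `α ∈ (0,1)`: for a probability measure `μ` on `[0,∞)` and a
slowly varying `L`, the tail `μ((t,∞)) ~ L(t)/t^α` holds iff
`-ψ_μ(-1/t) ~ (πα / sin(πα)) · L(t)/t^α` as `t → +∞`. -/
theorem tauberian_zero_one
    (μ : Measure ℝ) [IsProbabilityMeasure μ] (hsupp : μ (Set.Iio 0) = 0)
    (L : ℝ → ℝ) (hLpos : ∀ t : ℝ, 0 < t → 0 < L t) (hL : SlowlyVarying L)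
    (α : ℝ) (hα : α ∈ Set.Ioo (0 : ℝ) 1) :
    Tendsto (fun t : ℝ => (μ (Set.Ioi t)).toReal / (L t / t ^ α)) atTop (𝓝 1) ↔
      Tendsto (fun t : ℝ =>
        (-psi μ (-1 / t)) / ((π * α / Real.sin (π * α)) * (L t / t ^ α)))
        atTop (𝓝 1) := by
  have hK : 0 < π * α / Real.sin (π * α) := by
    have := hα.1
    have : 0 < Real.sin (π * α) :=
      Real.sin_pos_of_pos_of_lt_pi (by positivity) (mul_lt_of_lt_one_right pi_pos hα.2)
    positivity
  set K := π * α / Real.sin (π * α)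
  have hD : ∀ t : ℝ, 0 < t → 0 < L t / t ^ α := fun t ht => by
    have := hLpos t ht
    positivity
  constructor
  · intro h
    have hpos := eventually_pos_of_tendsto_div hD h
    have hratio := fun c (hc : 0 < c) =>
      hL.tendsto_ratio hLpos one_pos hc (by simpa only [one_mul] using h)
    have hmain := (tendsto_integral_div_tail_of_tendsto_ratio hsupp hpos hα hratio).mul
      (h.mul_const K⁻¹)
    rw [one_mul, mul_inv_cancel₀ hK.ne'] at hmain
    refine hmain.congr' ?_
    filter_upwards [hpos, eventually_gt_atTop 0] with t ht ht0
    have := hD t ht0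
    rw [neg_psi_neg_one_div μ ht0]
    field_simp
  · intro h
    have hpos := eventually_pos_of_tendsto_div (fun t ht => mul_pos hK (hD t ht)) h
    have hmain := (tendsto_tail_div_of_tendsto_ratio hsupp (fun t ht => neg_psi_neg_one_div μ ht)
      hpos hα fun c hc => hL.tendsto_ratio hLpos hK hc h).mul (h.mul_const K)
    rw [one_mul, inv_mul_cancel₀ hK.ne'] at hmain
    refine hmain.congr' ?_
    filter_upwards [hpos, eventually_gt_atTop 0] with t ht ht0
    have := hD t ht0
    generalize -psi μ (-1 / t) = H at ht ⊢
    field_simp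
end

section
/- Let μ be a Borel probability measure on [0,∞) with m₁(μ) < +∞, let L : (0,∞) → (0,∞) be slowly varying, and let α ∈ (1,2). Then the following are equivalent as t → +∞: (a) μ((t,∞)) ~ L(t)/t^α; (b) (−ψ_μ(−1/t) − m₁(μ)/t) / (L(t)/t^α) → πα/sin(πα), i.e. −ψ_μ(−1/t) = m₁(μ)/t + (πα/sin(πα)) (L(t)/t^α)(1+o(1)). (Note that sin(πα) < 0 for α ∈ (1,2).) -/
open MeasureTheory Filter Topology Real

theorem lintegral_rpow_mul_exp_neg_mul {a r : ℝ} (ha : 0 < a) (hr : 0 < r) :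
    ∫⁻ t in Set.Ioi (0 : ℝ), ENNReal.ofReal (t ^ (a - 1) * exp (-(r * t))) =
      ENNReal.ofReal ((1 / r) ^ a * Gamma a) := by
  have h := Real.integral_rpow_mul_exp_neg_mul_Ioi ha hr
  rw [← h, ofReal_integral_eq_lintegral_ofReal]
  · refine Integrable.of_integral_ne_zero ?_
    rw [h]
    have := Real.Gamma_pos_of_pos ha
    positivity
  · filter_upwards [ae_restrict_mem measurableSet_Ioi] with t ht
    have : (0 : ℝ) < t := ht
    simp only [Pi.zero_apply]
    positivity

theorem lintegral_rpow_div_one_add {s : ℝ} (hs0 : 0 < s) (hs1 : s < 1) :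
    ∫⁻ u in Set.Ioi (0 : ℝ), ENNReal.ofReal (u ^ (s - 1) / (1 + u)) =
      ENNReal.ofReal (π / sin (π * s)) := by
  have h1 : ∀ u ∈ Set.Ioi (0 : ℝ), ENNReal.ofReal (u ^ (s - 1) / (1 + u)) =
      ∫⁻ y in Set.Ioi (0 : ℝ), ENNReal.ofReal (u ^ (s - 1) * exp (-((1 + u) * y))) := by
    intro u (hu : 0 < u)
    have := lintegral_rpow_mul_exp_neg_mul one_pos (show 0 < 1 + u by linarith)
    simp only [sub_self, rpow_zero, one_mul, rpow_one, Gamma_one, mul_one] at this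
    simp_rw [ENNReal.ofReal_mul (rpow_nonneg hu.le (s - 1))]
    rw [lintegral_const_mul _ (by fun_prop), this, ← ENNReal.ofReal_mul (rpow_nonneg hu.le _)]
    rw [mul_one_div]
  have h2 : ∀ y ∈ Set.Ioi (0 : ℝ),
      ∫⁻ u in Set.Ioi (0 : ℝ), ENNReal.ofReal (u ^ (s - 1) * exp (-((1 + u) * y))) =
        ENNReal.ofReal (Gamma s) * ENNReal.ofReal (y ^ (1 - s - 1) * exp (-(1 * y))) := by
    intro y (hy : 0 < y)
    have := lintegral_rpow_mul_exp_neg_mul hs0 hy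
    have h3 : ∀ u : ℝ, ENNReal.ofReal (u ^ (s - 1) * exp (-((1 + u) * y))) =
        ENNReal.ofReal (exp (-y)) * ENNReal.ofReal (u ^ (s - 1) * exp (-(y * u))) := by
      intro u
      rw [← ENNReal.ofReal_mul (exp_pos _).le]
      congr 1
      rw [mul_left_comm, ← exp_add]
      congr 2
      ring
    simp_rw [h3]
    rw [lintegral_const_mul _ (by fun_prop), this, ← ENNReal.ofReal_mul (exp_pos _).le,
      ← ENNReal.ofReal_mul (Gamma_pos_of_pos hs0).le]
    congr 1
    rw [one_div, inv_rpow hy.le, ← rpow_neg hy.le, one_mul, show 1 - s - 1 = -s by ring]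
    ring
  rw [setLIntegral_congr_fun measurableSet_Ioi h1, lintegral_lintegral_swap (by fun_prop),
    setLIntegral_congr_fun measurableSet_Ioi h2, lintegral_const_mul _ (by fun_prop),
    lintegral_rpow_mul_exp_neg_mul (by linarith) one_pos,
    ← ENNReal.ofReal_mul (Gamma_pos_of_pos hs0).le]
  simp [← Real.Gamma_mul_Gamma_one_sub]

theorem integrableOn_rpow_div_one_add {s : ℝ} (hs0 : 0 < s) (hs1 : s < 1) :
    IntegrableOn (fun u : ℝ => u ^ (s - 1) / (1 + u)) (Set.Ioi 0) := by
  refine ⟨Measurable.aestronglyMeasurable (by fun_prop), ?_⟩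
  rw [hasFiniteIntegral_iff_ofReal, lintegral_rpow_div_one_add hs0 hs1]
  · exact ENNReal.ofReal_lt_top
  · filter_upwards [ae_restrict_mem measurableSet_Ioi] with u hu
    have : (0 : ℝ) < u := hu
    simp only [Pi.zero_apply]
    positivity

theorem integral_rpow_div_one_add {s : ℝ} (hs0 : 0 < s) (hs1 : s < 1) :
    ∫ u in Set.Ioi (0 : ℝ), u ^ (s - 1) / (1 + u) = π / sin (π * s) := by
  have hs : 0 < sin (π * s) :=
    sin_pos_of_pos_of_lt_pi (by positivity) (by nlinarith [pi_pos])
  rw [integral_eq_lintegral_of_nonneg_ae _ (Measurable.aestronglyMeasurable (by fun_prop)),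
    lintegral_rpow_div_one_add hs0 hs1,
    ENNReal.toReal_ofReal (by positivity)]
  filter_upwards [ae_restrict_mem measurableSet_Ioi] with u hu
  have : (0 : ℝ) < u := hu
  simp only [Pi.zero_apply]
  positivity

/-- Stieltjes transform of a power: `∫ u ^ (s - 1) / (l + u)` over `(0, ∞)`. -/
theorem integral_rpow_div_add {s : ℝ} (hs0 : 0 < s) (hs1 : s < 1) {l : ℝ} (hl : 0 < l) :
    ∫ u in Set.Ioi (0 : ℝ), u ^ (s - 1) / (l + u) = l ^ (s - 1) * (π / sin (π * s)) := by
  have h := integral_comp_mul_left_Ioi' (fun u : ℝ => u ^ (s - 1) / (l + u)) 0 hl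
  rw [mul_zero] at h
  rw [← h, ← integral_rpow_div_one_add hs0 hs1, ← integral_const_mul, smul_eq_mul,
    ← integral_const_mul]
  refine setIntegral_congr_fun measurableSet_Ioi fun u hu => ?_
  have hu : (0 : ℝ) < u := hu
  rw [mul_rpow hl.le hu.le]
  field_simp

/-- Mellin transform of the kernel `1 - 1 / (1 + u) ^ 2`, the derivative of `u ^ 2 / (1 + u)`. -/
theorem integral_kernel_mul_rpow {α : ℝ} (hα : α ∈ Set.Ioo (1 : ℝ) 2)
    (hint : IntegrableOn (fun u : ℝ => (1 - 1 / (1 + u) ^ 2) * u ^ (-α)) (Set.Ioi 0)) :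
    ∫ u in Set.Ioi (0 : ℝ), (1 - 1 / (1 + u) ^ 2) * u ^ (-α) = -(π * α / sin (π * α)) := by
  obtain ⟨h1, h2⟩ := hα
  have hi := integrableOn_rpow_div_one_add (s := 2 - α) (by linarith) (by linarith)
  have hF : ∀ u ∈ Set.Ioi (0 : ℝ), HasDerivAt (fun u : ℝ => u ^ (2 - α) / (1 + u))
      ((1 - 1 / (1 + u) ^ 2) * u ^ (-α) - α * (u ^ (2 - α - 1) / (1 + u))) u := by
    intro u (hu : 0 < u)
    have := ((hasDerivAt_id u).rpow_const (p := 2 - α) (Or.inl hu.ne')).div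
      ((hasDerivAt_id u).const_add 1) (by simp; positivity)
    refine HasDerivAt.congr_deriv (f := fun u : ℝ => u ^ (2 - α) / (1 + u)) this ?_
    simp only [id]
    have e1 : u ^ (2 - α) = u ^ 2 * u ^ (-α) := by
      rw [sub_eq_add_neg, rpow_add hu]; norm_num
    have e2 : u ^ (2 - α - 1) = u * u ^ (-α) := by
      rw [show 2 - α - 1 = 1 + -α by ring, rpow_add hu, rpow_one]
    rw [e1, e2]
    field_simp
    ring
  have h := integral_Ioi_of_hasDerivAt_of_tendsto (a := (0 : ℝ)) (m := 0) ?_ hF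
    (hint.sub (hi.const_mul α)) ?_
  · rw [integral_sub hint (hi.const_mul α), integral_const_mul,
      integral_rpow_div_one_add (by linarith) (by linarith),
      zero_rpow (by linarith)] at h
    rw [sub_eq_iff_eq_add.1 h, show π * (2 - α) = 2 * π - π * α by ring, sin_two_pi_sub]
    rw [div_neg]
    ring
  · refine ContinuousAt.continuousWithinAt ?_
    refine ContinuousAt.div ?_ (by fun_prop) (by norm_num)
    exact (continuous_id.rpow_const (fun _ => Or.inr (by linarith))).continuousAt
  · refine squeeze_zero' (g := fun u : ℝ => u ^ (-(α - 1))) ?_ ?_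
      (tendsto_rpow_neg_atTop (by linarith))
    · filter_upwards [eventually_gt_atTop 0] with u hu
      positivity
    · filter_upwards [eventually_gt_atTop 0] with u hu
      rw [div_le_iff₀ (by positivity), show 2 - α = -(α - 1) + 1 by ring, rpow_add hu, rpow_one]
      gcongr
      linarith

theorem Antitone.le_mul_rpow_neg_of_two_mul {H : ℝ → ℝ} (hH : Antitone H) (hpos : ∀ t, 0 < H t)
    {β t₀ : ℝ} (hβ : 0 < β) (ht₀ : 0 < t₀) (h2 : ∀ t ≥ t₀, H (2 * t) ≤ 2 ^ (-β) * H t)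
    {t u : ℝ} (ht : t₀ ≤ t) (hu : 1 ≤ u) : H (t * u) ≤ 2 ^ β * u ^ (-β) * H t := by
  have key : ∀ n : ℕ, H (2 ^ n * t) ≤ ((2 : ℝ) ^ n) ^ (-β) * H t := by
    intro n
    induction n with
    | zero => simp
    | succ n ih =>
      have h3 : t₀ ≤ 2 ^ n * t := ht.trans
        (le_mul_of_one_le_left (ht₀.le.trans ht) (one_le_pow₀ (by norm_num)))
      calc H (2 ^ (n + 1) * t) = H (2 * (2 ^ n * t)) := by congr 1; ring
        _ ≤ 2 ^ (-β) * H (2 ^ n * t) := h2 _ h3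
        _ ≤ 2 ^ (-β) * (((2 : ℝ) ^ n) ^ (-β) * H t) := by gcongr
        _ = ((2 : ℝ) ^ (n + 1)) ^ (-β) * H t := by
          rw [pow_succ', mul_rpow (by positivity) (by positivity), mul_assoc]
  obtain ⟨n, hn1, hn2⟩ := exists_nat_pow_near hu (one_lt_two)
  have htp : 0 < t := ht₀.trans_le ht
  calc H (t * u) ≤ H (2 ^ n * t) := hH (by rw [mul_comm]; gcongr)
    _ ≤ ((2 : ℝ) ^ n) ^ (-β) * H t := key n
    _ ≤ (u / 2) ^ (-β) * H t := by
      refine mul_le_mul_of_nonneg_right ?_ (hpos t).le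
      refine rpow_le_rpow_of_nonpos (by positivity) ?_ (by linarith)
      rw [pow_succ] at hn2
      linarith
    _ = 2 ^ β * u ^ (-β) * H t := by
      rw [div_rpow (by positivity) (by positivity), rpow_neg (by norm_num : (0 : ℝ) ≤ 2)]
      field_simp

theorem Antitone.le_mul_rpow_of_le_two_mul {H : ℝ → ℝ} (hH : Antitone H) (hpos : ∀ t, 0 < H t)
    {γ t₀ : ℝ} (hγ : 0 < γ) (ht₀ : 0 < t₀) (h2 : ∀ t ≥ t₀, 2 ^ (-γ) * H t ≤ H (2 * t))
    {t v : ℝ} (ht : t₀ ≤ t) (hv : 1 ≤ v) : H t ≤ 2 ^ γ * v ^ γ * H (t * v) := by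
  have key : ∀ n : ℕ, H t ≤ ((2 : ℝ) ^ n) ^ γ * H (2 ^ n * t) := by
    intro n
    induction n with
    | zero => simp
    | succ n ih =>
      have h3 : t₀ ≤ 2 ^ n * t := ht.trans
        (le_mul_of_one_le_left (ht₀.le.trans ht) (one_le_pow₀ (by norm_num)))
      have h4 := h2 _ h3
      rw [rpow_neg (by norm_num), inv_mul_le_iff₀ (by positivity)] at h4
      calc H t ≤ ((2 : ℝ) ^ n) ^ γ * H (2 ^ n * t) := ih
        _ ≤ ((2 : ℝ) ^ n) ^ γ * (2 ^ γ * H (2 * (2 ^ n * t))) := by gcongr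
        _ = ((2 : ℝ) ^ (n + 1)) ^ γ * H (2 ^ (n + 1) * t) := by
          rw [pow_succ', mul_rpow (by positivity) (by positivity)]
          ring_nf
  obtain ⟨n, hn1, hn2⟩ := exists_nat_pow_near hv (one_lt_two)
  have htp : 0 < t := ht₀.trans_le ht
  calc H t ≤ ((2 : ℝ) ^ (n + 1)) ^ γ * H (2 ^ (n + 1) * t) := key _
    _ ≤ (2 * v) ^ γ * H (t * v) := by
      refine mul_le_mul ?_ (hH ?_) (hpos _).le (by positivity)
      · refine rpow_le_rpow (by positivity) ?_ hγ.le
        rw [pow_succ']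
        linarith
      · rw [mul_comm]
        gcongr
    _ = 2 ^ γ * v ^ γ * H (t * v) := by rw [mul_rpow (by positivity) (by positivity)]

/-- Potter bounds for an antitone positive function with regular variation along doubling. -/
theorem exists_potter_bound {H : ℝ → ℝ} (hH : Antitone H) (hpos : ∀ t, 0 < H t)
    (hle : ∀ t, H t ≤ 1) {α β γ : ℝ} (hβ : 0 < β) (hβα : β < α) (hαγ : α < γ)
    (hreg : Tendsto (fun t => H (2 * t) / H t) atTop (𝓝 (2 ^ (-α)))) :
    ∃ C > 0, ∀ᶠ t in atTop, ∀ u > 0,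
      H (t * u) / H t ≤ if u ≤ 1 then C * u ^ (-γ) else C * u ^ (-β) := by
  have e1 : ∀ᶠ t in atTop, H (2 * t) / H t < 2 ^ (-β) :=
    hreg.eventually_lt_const (rpow_lt_rpow_of_exponent_lt one_lt_two (by linarith))
  have e2 : ∀ᶠ t in atTop, 2 ^ (-γ) < H (2 * t) / H t :=
    hreg.eventually_const_lt (rpow_lt_rpow_of_exponent_lt one_lt_two (by linarith))
  obtain ⟨t₁, ht₁⟩ := eventually_atTop.1 (e1.and e2)
  set t₀ := max t₁ 1
  have ht₀ : 0 < t₀ := lt_max_of_lt_right one_pos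
  have hγ : 0 < γ := by linarith
  have h1 : ∀ t ≥ t₀, H (2 * t) ≤ 2 ^ (-β) * H t := fun t ht =>
    ((div_lt_iff₀ (hpos t)).1 (ht₁ t (le_of_max_le_left ht)).1).le
  have h2 : ∀ t ≥ t₀, 2 ^ (-γ) * H t ≤ H (2 * t) := fun t ht =>
    ((lt_div_iff₀ (hpos t)).1 (ht₁ t (le_of_max_le_left ht)).2).le
  have hC1 : (2 : ℝ) ^ β ≤ 2 ^ γ / H t₀ := by
    rw [le_div_iff₀ (hpos _)]
    have : (2 : ℝ) ^ β ≤ 2 ^ γ := rpow_le_rpow_of_exponent_le one_le_two (by linarith)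
    have h3 : (0 : ℝ) < 2 ^ β := by positivity
    nlinarith [hle t₀, hpos t₀]
  have hC2 : (2 : ℝ) ^ γ ≤ 2 ^ γ / H t₀ := by
    rw [le_div_iff₀ (hpos _)]
    have h3 : (0 : ℝ) < 2 ^ γ := by positivity
    nlinarith [hle t₀, hpos t₀]
  refine ⟨2 ^ γ / H t₀, div_pos (by positivity) (hpos _), ?_⟩
  filter_upwards [eventually_ge_atTop t₀] with t ht u hu
  have htp : 0 < t := ht₀.trans_le ht
  rw [div_le_iff₀ (hpos t)]
  split_ifs with h
  · have hun : u ^ (-γ) = (1 / u) ^ γ := by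
      rw [one_div, inv_rpow hu.le, rpow_neg hu.le]
    rw [hun]
    rcases le_or_gt t₀ (t * u) with h3 | h3
    · have := hH.le_mul_rpow_of_le_two_mul hpos hγ ht₀ h2 h3 (v := 1 / u)
        (by rw [le_div_iff₀ hu]; linarith)
      rw [mul_one_div, mul_div_cancel_right₀ _ hu.ne'] at this
      refine this.trans ?_
      have := hpos t
      gcongr
    · have h4 := hH.le_mul_rpow_of_le_two_mul hpos hγ ht₀ h2 le_rfl (v := t / t₀)
        (by rw [le_div_iff₀ ht₀]; linarith)
      rw [mul_div_cancel₀ _ ht₀.ne'] at h4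
      have h5 : (t / t₀) ^ γ ≤ (1 / u) ^ γ := by
        refine rpow_le_rpow (by positivity) ?_ hγ.le
        rw [div_le_div_iff₀ ht₀ hu]
        linarith
      have := hpos t
      have := hpos t₀
      calc H (t * u) ≤ 1 := hle _
        _ = H t₀ / H t₀ := (div_self (hpos _).ne').symm
        _ ≤ 2 ^ γ * (1 / u) ^ γ * H t / H t₀ := by
          gcongr
          exact h4.trans (by gcongr)
        _ = _ := by ring
  · have := hH.le_mul_rpow_neg_of_two_mul hpos hβ ht₀ h1 ht (not_le.1 h).le
    refine this.trans ?_
    have := hpos t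
    gcongr

theorem one_sub_one_div_sq_nonneg {u : ℝ} (hu : 0 ≤ u) : 0 ≤ 1 - 1 / (1 + u) ^ 2 := by
  rw [sub_nonneg, div_le_one (by positivity)]
  nlinarith

theorem one_sub_one_div_sq_le {u : ℝ} (hu : 0 ≤ u) : 1 - 1 / (1 + u) ^ 2 ≤ 2 * u := by
  rw [sub_le_iff_le_add, ← sub_le_iff_le_add', le_div_iff₀ (by positivity)]
  nlinarith [pow_nonneg hu 3, pow_nonneg hu 2]

theorem integrableOn_kernel_bound {C β γ : ℝ} (hβ : 1 < β) (hγ : γ < 2) :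
    IntegrableOn (fun u : ℝ => (1 - 1 / (1 + u) ^ 2) *
      (if u ≤ 1 then C * u ^ (-γ) else C * u ^ (-β))) (Set.Ioi 0) := by
  have hm : Measurable (fun u : ℝ => (1 - 1 / (1 + u) ^ 2) *
      (if u ≤ 1 then C * u ^ (-γ) else C * u ^ (-β))) :=
    Measurable.mul (by fun_prop)
      (Measurable.ite measurableSet_Iic (by fun_prop) (by fun_prop))
  rw [← Set.Ioc_union_Ioi_eq_Ioi (zero_le_one (α := ℝ)), integrableOn_union]
  constructor
  · have h1 : IntegrableOn (fun u : ℝ => 2 * |C| * u ^ (1 - γ)) (Set.Ioc 0 1) :=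
      ((intervalIntegrable_iff_integrableOn_Ioc_of_le zero_le_one).1
        (intervalIntegral.intervalIntegrable_rpow' (by linarith))).const_mul _
    refine h1.mono' hm.aestronglyMeasurable ?_
    filter_upwards [ae_restrict_mem measurableSet_Ioc] with u hu
    rw [if_pos hu.2, norm_mul, norm_mul, norm_eq_abs, norm_eq_abs, norm_eq_abs,
      abs_of_nonneg (one_sub_one_div_sq_nonneg hu.1.le), abs_of_nonneg (rpow_nonneg hu.1.le _),
      show 1 - γ = 1 + -γ by ring, rpow_add hu.1, rpow_one]
    have := hu.1
    have h2 := one_sub_one_div_sq_le hu.1.le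
    calc _ ≤ 2 * u * (|C| * u ^ (-γ)) := by gcongr
      _ = _ := by ring
  · have h1 : IntegrableOn (fun u : ℝ => |C| * u ^ (-β)) (Set.Ioi 1) :=
      (integrableOn_Ioi_rpow_of_lt (by linarith) one_pos).const_mul _
    refine h1.mono' hm.aestronglyMeasurable ?_
    filter_upwards [ae_restrict_mem measurableSet_Ioi] with u hu
    have hu : 1 < u := hu
    have hu0 : 0 < u := by linarith
    rw [if_neg (not_le.2 hu), norm_mul, norm_mul, norm_eq_abs, norm_eq_abs, norm_eq_abs,
      abs_of_nonneg (one_sub_one_div_sq_nonneg hu0.le), abs_of_nonneg (rpow_nonneg hu0.le _)]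
    refine mul_le_of_le_one_left (by positivity) ?_
    have : 0 ≤ 1 / (1 + u) ^ 2 := by positivity
    linarith

theorem integrableOn_kernel_mul_rpow {α : ℝ} (hα : α ∈ Set.Ioo (1 : ℝ) 2) :
    IntegrableOn (fun u : ℝ => (1 - 1 / (1 + u) ^ 2) * u ^ (-α)) (Set.Ioi 0) := by
  simpa using integrableOn_kernel_bound (C := 1) hα.1 hα.2

theorem tendsto_integral_kernel_mul {H : ℝ → ℝ} (hH : Antitone H) (hpos : ∀ t, 0 < H t)
    (hle : ∀ t, H t ≤ 1) {α : ℝ} (hα : α ∈ Set.Ioo (1 : ℝ) 2)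
    (hreg : ∀ l : ℝ, 0 < l → Tendsto (fun t => H (l * t) / H t) atTop (𝓝 (l ^ (-α)))) :
    Tendsto (fun t => ∫ u in Set.Ioi (0 : ℝ), (1 - 1 / (1 + u) ^ 2) * (H (t * u) / H t)) atTop
      (𝓝 (∫ u in Set.Ioi (0 : ℝ), (1 - 1 / (1 + u) ^ 2) * u ^ (-α))) := by
  obtain ⟨h1, h2⟩ := hα
  obtain ⟨C, hC, hb⟩ := exists_potter_bound hH hpos hle (β := (1 + α) / 2) (γ := (α + 2) / 2)
    (by linarith) (by linarith) (by linarith) (hreg 2 two_pos)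
  refine tendsto_integral_filter_of_dominated_convergence _ ?_ ?_
    (integrableOn_kernel_bound (C := C) (β := (1 + α) / 2) (γ := (α + 2) / 2)
      (by linarith) (by linarith)) ?_
  · refine Eventually.of_forall fun t => Measurable.aestronglyMeasurable ?_
    have := hH.measurable
    fun_prop
  · filter_upwards [hb] with t ht
    filter_upwards [ae_restrict_mem measurableSet_Ioi] with u hu
    have hu0 : (0 : ℝ) < u := hu
    rw [norm_mul, norm_eq_abs, norm_eq_abs, abs_of_nonneg (one_sub_one_div_sq_nonneg hu0.le),
      abs_of_nonneg (div_nonneg (hpos _).le (hpos _).le)]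
    exact mul_le_mul_of_nonneg_left (ht u hu0) (one_sub_one_div_sq_nonneg hu0.le)
  · filter_upwards [ae_restrict_mem measurableSet_Ioi] with u hu
    refine (tendsto_const_nhds).mul ?_
    simpa only [mul_comm u] using hreg u hu

section Moments

variable {ι : Type*} {l : Filter ι} {σ : ι → Measure ℝ} {τ : Measure ℝ}

theorem integrable_of_bound_Icc {ρ : Measure ℝ} [IsFiniteMeasure ρ]
    (hρ : ∀ᵐ v ∂ρ, v ∈ Set.Icc (0 : ℝ) 1) {f : ℝ → ℝ} (hf : Measurable f) {C : ℝ}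
    (hC : ∀ v ∈ Set.Icc (0 : ℝ) 1, |f v| ≤ C) : Integrable f ρ :=
  .of_bound hf.aestronglyMeasurable C (hρ.mono hC)

theorem abs_integral_sub_le_of_Icc {ρ : Measure ℝ} (hρ1 : ρ Set.univ ≤ 1)
    (hρ : ∀ᵐ v ∂ρ, v ∈ Set.Icc (0 : ℝ) 1) {f g : ℝ → ℝ} (hf : Measurable f) (hg : Measurable g)
    {C ε : ℝ} (hε : 0 ≤ ε) (hC : ∀ v ∈ Set.Icc (0 : ℝ) 1, |f v| ≤ C)
    (hfg : ∀ v ∈ Set.Icc (0 : ℝ) 1, |f v - g v| ≤ ε) :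
    |∫ v, f v ∂ρ - ∫ v, g v ∂ρ| ≤ ε := by
  have : IsFiniteMeasure ρ := ⟨hρ1.trans_lt ENNReal.one_lt_top⟩
  have hgC : ∀ v ∈ Set.Icc (0 : ℝ) 1, |g v| ≤ C + ε := fun v hv => by
    have h1 := hC v hv
    have h2 := hfg v hv
    rw [abs_le] at *
    constructor <;> linarith
  rw [← integral_sub (integrable_of_bound_Icc hρ hf hC) (integrable_of_bound_Icc hρ hg hgC)]
  refine (norm_integral_le_of_norm_le_const (f := fun v => f v - g v) (C := ε)
    (hρ.mono hfg)).trans ?_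
  refine mul_le_of_le_one_right hε ?_
  exact ENNReal.toReal_le_of_le_ofReal zero_le_one (by simpa using hρ1)

theorem tendsto_integral_of_approx
    (hσ1 : ∀ᶠ i in l, σ i Set.univ ≤ 1) (hσ : ∀ᶠ i in l, ∀ᵐ v ∂σ i, v ∈ Set.Icc (0 : ℝ) 1)
    (hτ1 : τ Set.univ ≤ 1) (hτ : ∀ᵐ v ∂τ, v ∈ Set.Icc (0 : ℝ) 1)
    {f : ℝ → ℝ} (hf : Measurable f) {C : ℝ} (hC : ∀ v ∈ Set.Icc (0 : ℝ) 1, |f v| ≤ C)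
    (happ : ∀ ε > 0, ∃ g : ℝ → ℝ, Measurable g ∧ (∀ v ∈ Set.Icc (0 : ℝ) 1, |f v - g v| ≤ ε) ∧
      Tendsto (fun i => ∫ v, g v ∂σ i) l (𝓝 (∫ v, g v ∂τ))) :
    Tendsto (fun i => ∫ v, f v ∂σ i) l (𝓝 (∫ v, f v ∂τ)) := by
  rw [Metric.tendsto_nhds]
  intro ε hε
  obtain ⟨g, hg, hfg, hlim⟩ := happ (ε / 4) (by positivity)
  have h2 := abs_integral_sub_le_of_Icc hτ1 hτ hf hg (by positivity) hC hfg
  filter_upwards [hσ1, hσ, Metric.tendsto_nhds.1 hlim (ε / 4) (by positivity)] with i h3 h4 h5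
  have h6 := abs_integral_sub_le_of_Icc h3 h4 hf hg (by positivity) hC hfg
  rw [Real.dist_eq] at *
  rw [abs_le] at h2 h6
  rw [abs_lt] at *
  constructor <;> linarith [h2.1, h2.2, h6.1, h6.2, h5.1, h5.2]

/-- On `[0,1]`, convergence of the Stieltjes transforms implies convergence of the integrals of
continuous functions. -/
theorem tendsto_integral_of_tendsto_stieltjes
    (hσ1 : ∀ᶠ i in l, σ i Set.univ ≤ 1) (hσ : ∀ᶠ i in l, ∀ᵐ v ∂σ i, v ∈ Set.Icc (0 : ℝ) 1)
    (hτ1 : τ Set.univ ≤ 1) (hτ : ∀ᵐ v ∂τ, v ∈ Set.Icc (0 : ℝ) 1)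
    (hS : ∀ s : ℝ, 0 ≤ s →
      Tendsto (fun i => ∫ v, 1 / (1 + s * v) ∂σ i) l (𝓝 (∫ v, 1 / (1 + s * v) ∂τ)))
    {f : ℝ → ℝ} (hf : Continuous f) :
    Tendsto (fun i => ∫ v, f v ∂σ i) l (𝓝 (∫ v, f v ∂τ)) := by
  have hτf : IsFiniteMeasure τ := ⟨hτ1.trans_lt ENNReal.one_lt_top⟩
  have hb : ∀ (n : ℕ) (s : ℝ), 0 ≤ s → ∀ v ∈ Set.Icc (0 : ℝ) 1, |v ^ n / (1 + s * v)| ≤ 1 := by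
    intro n s hs v hv
    have h1 : 0 ≤ s * v := mul_nonneg hs hv.1
    have h2 := pow_nonneg hv.1 n
    rw [abs_of_nonneg (by positivity), div_le_one (by positivity)]
    linarith [pow_le_one₀ hv.1 hv.2 (n := n)]
  have hm : ∀ (n : ℕ) (s : ℝ), Measurable fun v : ℝ => v ^ n / (1 + s * v) :=
    fun n s => by fun_prop
  have key : ∀ (n : ℕ) (s : ℝ), 0 ≤ s →
      Tendsto (fun i => ∫ v, v ^ n / (1 + s * v) ∂σ i) l (𝓝 (∫ v, v ^ n / (1 + s * v) ∂τ)) := by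
    intro n
    induction n with
    | zero => simpa using hS
    | succ n ih =>
      have hpos : ∀ s : ℝ, 0 < s → Tendsto (fun i => ∫ v, v ^ (n + 1) / (1 + s * v) ∂σ i) l
          (𝓝 (∫ v, v ^ (n + 1) / (1 + s * v) ∂τ)) := by
        intro s hs
        have hid : ∀ ρ : Measure ℝ, ρ Set.univ ≤ 1 → (∀ᵐ v ∂ρ, v ∈ Set.Icc (0 : ℝ) 1) →
            ∫ v, v ^ (n + 1) / (1 + s * v) ∂ρ =
              s⁻¹ * (∫ v, v ^ n / (1 + 0 * v) ∂ρ - ∫ v, v ^ n / (1 + s * v) ∂ρ) := by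
          intro ρ h1 h2
          have : IsFiniteMeasure ρ := ⟨h1.trans_lt ENNReal.one_lt_top⟩
          rw [← integral_sub (integrable_of_bound_Icc h2 (hm n 0) (hb n 0 le_rfl))
            (integrable_of_bound_Icc h2 (hm n s) (hb n s hs.le)), ← integral_const_mul]
          refine integral_congr_ae (h2.mono fun v hv => ?_)
          have : 0 < 1 + s * v := by have := mul_nonneg hs.le hv.1; linarith
          simp only
          field_simp
          ring
        rw [hid τ hτ1 hτ]
        refine Tendsto.congr' ?_ (((ih 0 le_rfl).sub (ih s hs.le)).const_mul s⁻¹)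
        filter_upwards [hσ1, hσ] with i h1 h2 using (hid _ h1 h2).symm
      intro s hs
      rcases hs.eq_or_lt with rfl | hs
      · refine tendsto_integral_of_approx hσ1 hσ hτ1 hτ (hm _ _) (hb _ _ le_rfl) ?_
        intro ε hε
        refine ⟨_, hm (n + 1) ε, fun v hv => ?_, hpos ε hε⟩
        have h0 : 0 ≤ ε * v := mul_nonneg hε.le hv.1
        have h1 : v ^ (n + 1) / (1 + 0 * v) - v ^ (n + 1) / (1 + ε * v) =
            ε * (v ^ (n + 2) / (1 + ε * v)) := by
          have : 0 < 1 + ε * v := by linarith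
          rw [zero_mul, add_zero, div_one, sub_eq_iff_eq_add, mul_div_assoc', ← add_div,
            eq_div_iff this.ne']
          ring
        rw [h1, abs_mul, abs_of_pos hε]
        exact mul_le_of_le_one_right hε.le (hb _ _ hε.le v hv)
      · exact hpos s hs
  have hpoly : ∀ p : Polynomial ℝ,
      Tendsto (fun i => ∫ v, p.eval v ∂σ i) l (𝓝 (∫ v, p.eval v ∂τ)) := by
    intro p
    have hid : ∀ ρ : Measure ℝ, ρ Set.univ ≤ 1 → (∀ᵐ v ∂ρ, v ∈ Set.Icc (0 : ℝ) 1) →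
        ∫ v, p.eval v ∂ρ =
          ∑ n ∈ Finset.range (p.natDegree + 1), p.coeff n * ∫ v, v ^ n / (1 + 0 * v) ∂ρ := by
      intro ρ h1 h2
      have : IsFiniteMeasure ρ := ⟨h1.trans_lt ENNReal.one_lt_top⟩
      simp_rw [← integral_const_mul, Polynomial.eval_eq_sum_range]
      rw [← integral_finsetSum _ fun n _ =>
        (integrable_of_bound_Icc h2 (hm n 0) (hb n 0 le_rfl)).const_mul _]
      simp
    rw [hid τ hτ1 hτ]
    refine Tendsto.congr' ?_
      (tendsto_finsetSum _ fun n _ => (key n 0 le_rfl).const_mul (p.coeff n))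
    filter_upwards [hσ1, hσ] with i h1 h2 using (hid _ h1 h2).symm
  obtain ⟨C, hC⟩ := isCompact_Icc.exists_bound_of_continuousOn (hf.continuousOn (s := Set.Icc 0 1))
  refine tendsto_integral_of_approx hσ1 hσ hτ1 hτ hf.measurable hC fun ε hε => ?_
  obtain ⟨p, hp⟩ := exists_polynomial_near_of_continuousOn 0 1 f hf.continuousOn ε hε
  exact ⟨_, p.continuous.measurable, fun v hv => by rw [abs_sub_comm]; exact (hp v hv).le, hpoly p⟩

/-- Convergence of the integrals of continuous functions on `[0,1]` extends to functions with a
jump at a point of measure zero for the limit. -/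
theorem tendsto_integral_indicator_Iio
    (hσ1 : ∀ᶠ i in l, σ i Set.univ ≤ 1) (hσ : ∀ᶠ i in l, ∀ᵐ v ∂σ i, v ∈ Set.Icc (0 : ℝ) 1)
    (hτ1 : τ Set.univ ≤ 1) (hτ : ∀ᵐ v ∂τ, v ∈ Set.Icc (0 : ℝ) 1)
    (hlim : ∀ f : ℝ → ℝ, Continuous f →
      Tendsto (fun i => ∫ v, f v ∂σ i) l (𝓝 (∫ v, f v ∂τ)))
    {w : ℝ → ℝ} (hw : Continuous w) (hw0 : ∀ v ∈ Set.Icc (0 : ℝ) 1, 0 ≤ w v) {a : ℝ}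
    (ha : τ {a} = 0) :
    Tendsto (fun i => ∫ v, (Set.Iio a).indicator w v ∂σ i) l
      (𝓝 (∫ v, (Set.Iio a).indicator w v ∂τ)) := by
  have hτf : IsFiniteMeasure τ := ⟨hτ1.trans_lt ENNReal.one_lt_top⟩
  obtain ⟨C, hC⟩ := isCompact_Icc.exists_bound_of_continuousOn (hw.continuousOn (s := Set.Icc 0 1))
  set p : ℕ → ℝ → ℝ := fun n v => max 0 (min 1 (1 - n * (v - a)))
  set q : ℕ → ℝ → ℝ := fun n v => max 0 (min 1 (n * (a - v)))
  have hpc : ∀ n, Continuous (p n) := fun n => by fun_prop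
  have hqc : ∀ n, Continuous (q n) := fun n => by fun_prop
  have hp0 : ∀ n v, 0 ≤ p n v := fun n v => le_max_left _ _
  have hq0 : ∀ n v, 0 ≤ q n v := fun n v => le_max_left _ _
  have hp1 : ∀ n v, p n v ≤ 1 := fun n v => max_le zero_le_one (min_le_left _ _)
  have hq1 : ∀ n v, q n v ≤ 1 := fun n v => max_le zero_le_one (min_le_left _ _)
  have hpl : ∀ n, ∀ v < a, p n v = 1 := fun n v hv => by
    have : 0 ≤ (n : ℝ) * (a - v) := mul_nonneg n.cast_nonneg (by linarith)
    simp only [p]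
    rw [min_eq_left (by linarith), max_eq_right zero_le_one]
  have hqr : ∀ n, ∀ v ≥ a, q n v = 0 := fun n v hv => by
    have : 0 ≤ (n : ℝ) * (v - a) := mul_nonneg n.cast_nonneg (by linarith)
    simp only [q]
    rw [max_eq_left]
    exact (min_le_right _ _).trans (by linarith)
  have hI : ∀ (ρ : Measure ℝ) [IsFiniteMeasure ρ], (∀ᵐ v ∂ρ, v ∈ Set.Icc (0 : ℝ) 1) →
      ∀ g : ℝ → ℝ, Measurable g → (∀ v, 0 ≤ g v) → (∀ v, g v ≤ 1) →
        Integrable (fun v => g v * w v) ρ := by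
    intro ρ _ hρ g hg hg0 hg1
    refine integrable_of_bound_Icc hρ (hg.mul hw.measurable) (C := C) fun v hv => ?_
    rw [abs_mul, abs_of_nonneg (hg0 v)]
    exact (mul_le_of_le_one_left (abs_nonneg _) (hg1 v)).trans (hC v hv)
  set h : ℝ → ℝ := (Set.Iio a).indicator 1
  have hhm : Measurable h := measurable_one.indicator measurableSet_Iio
  have hh0 : ∀ v, 0 ≤ h v := fun v => Set.indicator_nonneg (fun _ _ => zero_le_one) v
  have hh1 : ∀ v, h v ≤ 1 := fun v => Set.indicator_le_self' (fun _ _ => zero_le_one) v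
  have hhl : ∀ v < a, h v = 1 := fun v hv => Set.indicator_of_mem (Set.mem_Iio.2 hv) _
  have hhr : ∀ v ≥ a, h v = 0 := fun v hv => Set.indicator_of_notMem (by simpa using hv) _
  have hh : (Set.Iio a).indicator w = fun v => h v * w v := by
    ext v
    rcases lt_or_ge v a with hv | hv
    · rw [hhl v hv, one_mul, Set.indicator_of_mem (Set.mem_Iio.2 hv)]
    · rw [hhr v hv, zero_mul, Set.indicator_of_notMem (by simpa using hv)]
  have hDCT : ∀ g : ℕ → ℝ → ℝ, (∀ n, Continuous (g n)) → (∀ n v, 0 ≤ g n v) →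
      (∀ n v, g n v ≤ 1) → (∀ v ≠ a, Tendsto (fun n => g n v) atTop (𝓝 (h v))) →
      Tendsto (fun n => ∫ v, g n v * w v ∂τ) atTop (𝓝 (∫ v, h v * w v ∂τ)) := by
    intro g hg hg0 hg1 hgl
    refine tendsto_integral_of_dominated_convergence (fun _ => C)
      (fun n => ((hg n).mul hw).aestronglyMeasurable) (integrable_const _) ?_ ?_
    · intro n
      filter_upwards [hτ] with v hv
      rw [norm_mul, norm_eq_abs, abs_of_nonneg (hg0 n v)]
      exact (mul_le_of_le_one_left (norm_nonneg _) (hg1 n v)).trans (hC v hv)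
    · have : ∀ᵐ v ∂τ, v ≠ a := compl_mem_ae_iff.2 ha
      filter_upwards [this] with v hv using (hgl v hv).mul_const _
  have hP := hDCT p hpc hp0 hp1 fun v hv => by
    rcases lt_or_gt_of_ne hv with hv | hv
    · simp only [hpl _ v hv, hhl v hv]
      exact tendsto_const_nhds
    · rw [hhr v hv.le]
      refine tendsto_const_nhds.congr' ?_
      filter_upwards [(tendsto_natCast_atTop_atTop (R := ℝ)).eventually_ge_atTop
        (1 / (v - a))] with n hn
      rw [div_le_iff₀ (by linarith)] at hn
      exact (max_eq_left ((min_le_right _ _).trans (by linarith))).symm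
  have hQ := hDCT q hqc hq0 hq1 fun v hv => by
    rcases lt_or_gt_of_ne hv with hv | hv
    · rw [hhl v hv]
      refine tendsto_const_nhds.congr' ?_
      filter_upwards [(tendsto_natCast_atTop_atTop (R := ℝ)).eventually_ge_atTop
        (1 / (a - v))] with n hn
      rw [div_le_iff₀ (by linarith)] at hn
      simp only [q, min_eq_left hn, max_eq_right (zero_le_one (α := ℝ))]
    · simp only [hqr _ v hv.le, hhr v hv.le]
      exact tendsto_const_nhds
  rw [hh, tendsto_order]
  constructor
  · intro b hb
    obtain ⟨n, hn⟩ := (hQ.eventually_const_lt hb).exists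
    filter_upwards [hσ1, hσ, (hlim _ ((hqc n).mul hw)).eventually_const_lt hn] with i h1 h2 h3
    have : IsFiniteMeasure (σ i) := ⟨h1.trans_lt ENNReal.one_lt_top⟩
    refine h3.trans_le (integral_mono_ae (hI _ h2 _ (hqc n).measurable (hq0 n) (hq1 n))
      (hI _ h2 _ hhm hh0 hh1) (h2.mono fun v hv => ?_))
    refine mul_le_mul_of_nonneg_right ?_ (hw0 v hv)
    rcases lt_or_ge v a with hv | hv
    · rw [hhl v hv]; exact hq1 n v
    · rw [hqr n v hv]; exact hh0 v
  · intro b hb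
    obtain ⟨n, hn⟩ := (hP.eventually_lt_const hb).exists
    filter_upwards [hσ1, hσ, (hlim _ ((hpc n).mul hw)).eventually_lt_const hn] with i h1 h2 h3
    have : IsFiniteMeasure (σ i) := ⟨h1.trans_lt ENNReal.one_lt_top⟩
    refine (integral_mono_ae (hI _ h2 _ hhm hh0 hh1)
      (hI _ h2 _ (hpc n).measurable (hp0 n) (hp1 n)) (h2.mono fun v hv => ?_)).trans_lt h3
    refine mul_le_mul_of_nonneg_right ?_ (hw0 v hv)
    rcases lt_or_ge v a with hv | hv
    · rw [hpl n v hv]; exact hh1 v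
    · rw [hhr v hv]; exact hp0 n v

end Moments

/-- The second-order remainder of `psi μ (-1 / t)` after subtracting the first moment term. -/
noncomputable def psiRemainder (μ : Measure ℝ) (t : ℝ) : ℝ := ∫ x, (x / t) ^ 2 / (1 + x / t) ∂μ

section Remainder

variable {μ : Measure ℝ}

theorem integrable_psiRemainder (hsupp : ∀ᵐ x ∂μ, 0 ≤ x) (hm1 : Integrable (fun t : ℝ => t) μ)
    {t : ℝ} (ht : 0 < t) : Integrable (fun x => (x / t) ^ 2 / (1 + x / t)) μ := by
  refine (hm1.div_const t).mono' (Measurable.aestronglyMeasurable (by fun_prop)) ?_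
  filter_upwards [hsupp] with x hx
  have hu : 0 ≤ x / t := by positivity
  rw [norm_eq_abs, abs_of_nonneg (by positivity), div_le_iff₀ (by positivity)]
  nlinarith

theorem neg_psi_sub_eq (hsupp : ∀ᵐ x ∂μ, 0 ≤ x) (hm1 : Integrable (fun t : ℝ => t) μ)
    {t : ℝ} (ht : 0 < t) : -psi μ (-1 / t) - (∫ x, x ∂μ) / t = -psiRemainder μ t := by
  have h : psi μ (-1 / t) = ∫ x, ((x / t) ^ 2 / (1 + x / t) - x / t) ∂μ := by
    refine integral_congr_ae ?_
    filter_upwards [hsupp] with x hx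
    have : 0 < t + x := by positivity
    have h1 : (1 : ℝ) - -1 / t * x = (t + x) / t := by field_simp; ring
    have h2 : (1 : ℝ) + x / t = (t + x) / t := by field_simp
    rw [h1, h2]
    field_simp
    ring
  rw [h, integral_sub (integrable_psiRemainder hsupp hm1 ht) (hm1.div_const t), integral_div,
    psiRemainder]
  ring

theorem psiRemainder_nonneg (hsupp : ∀ᵐ x ∂μ, 0 ≤ x) {t : ℝ} (ht : 0 < t) :
    0 ≤ psiRemainder μ t := by
  refine integral_nonneg_of_ae ?_
  filter_upwards [hsupp] with x hx
  simp only [Pi.zero_apply]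
  positivity

theorem hasDerivAt_sq_div_one_add {u : ℝ} (hu : 0 ≤ u) :
    HasDerivAt (fun u : ℝ => u ^ 2 / (1 + u)) (1 - 1 / (1 + u) ^ 2) u := by
  have h := ((hasDerivAt_id u).pow 2).div ((hasDerivAt_id u).const_add 1)
    (by simp only [id]; positivity)
  refine HasDerivAt.congr_deriv (f := fun u : ℝ => u ^ 2 / (1 + u)) h ?_
  simp only [id]
  have : 0 < 1 + u := by linarith
  simp
  field_simp
  ring

theorem intervalIntegrable_kernel {y : ℝ} (hy : 0 ≤ y) :
    IntervalIntegrable (fun u : ℝ => 1 - 1 / (1 + u) ^ 2) volume 0 y := by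
  refine ContinuousOn.intervalIntegrable ?_
  rw [Set.uIcc_of_le hy]
  refine continuousOn_const.sub (continuousOn_const.div (by fun_prop) fun u hu => ?_)
  have := hu.1
  positivity

theorem integral_kernel_eq {y : ℝ} (hy : 0 ≤ y) :
    ∫ u in (0 : ℝ)..y, (1 - 1 / (1 + u) ^ 2) = y ^ 2 / (1 + y) := by
  rw [intervalIntegral.integral_eq_sub_of_hasDerivAt (f := fun u : ℝ => u ^ 2 / (1 + u)) ?_
    (intervalIntegrable_kernel hy)]
  · simp
  · intro u hu
    rw [Set.uIcc_of_le hy] at hu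
    exact hasDerivAt_sq_div_one_add hu.1

variable [IsProbabilityMeasure μ]

theorem psiRemainder_eq_integral_tail (hsupp : ∀ᵐ x ∂μ, 0 ≤ x) {t : ℝ} (ht : 0 < t) :
    psiRemainder μ t =
      ∫ u in Set.Ioi (0 : ℝ), (1 - 1 / (1 + u) ^ 2) * μ.real (Set.Ioi (t * u)) := by
  have hanti : Antitone fun t => μ.real (Set.Ioi t) := fun a b hab =>
    measureReal_mono (Set.Ioi_subset_Ioi hab)
  have hm := hanti.measurable
  have hl := lintegral_comp_eq_lintegral_meas_lt_mul μ (f := fun x => x / t)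
    (g := fun u => 1 - 1 / (1 + u) ^ 2)
    (hsupp.mono fun x hx => div_nonneg hx ht.le) (by fun_prop)
    (fun u hu => intervalIntegrable_kernel hu.le)
    ((ae_restrict_mem measurableSet_Ioi).mono fun u hu => one_sub_one_div_sq_nonneg (le_of_lt hu))
  rw [psiRemainder, integral_eq_lintegral_of_nonneg_ae, integral_eq_lintegral_of_nonneg_ae]
  · congr 1
    calc _ = _ := lintegral_congr_ae (hsupp.mono fun x hx => by
            rw [integral_kernel_eq (div_nonneg hx ht.le)])
      _ = _ := hl
      _ = _ := by
        refine setLIntegral_congr_fun measurableSet_Ioi fun u hu => ?_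
        have : {a | u < a / t} = Set.Ioi (t * u) := by
          ext a
          simp [lt_div_iff₀ ht, mul_comm]
        rw [this, ENNReal.ofReal_mul (one_sub_one_div_sq_nonneg (le_of_lt hu)), mul_comm,
          ofReal_measureReal]
  · filter_upwards [ae_restrict_mem measurableSet_Ioi] with u hu
    exact mul_nonneg (one_sub_one_div_sq_nonneg (le_of_lt hu)) measureReal_nonneg
  · exact (Measurable.mul (by fun_prop) (hm.comp (measurable_const_mul t))).aestronglyMeasurable
  · filter_upwards [hsupp] with x hx
    simp only [Pi.zero_apply]
    positivity
  · exact Measurable.aestronglyMeasurable (by fun_prop)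

/-- A regularly varying tail determines the asymptotics of the remainder. -/
theorem tendsto_psiRemainder_div_tail (hsupp : ∀ᵐ x ∂μ, 0 ≤ x)
    (hpos : ∀ t, 0 < μ.real (Set.Ioi t)) {α : ℝ} (hα : α ∈ Set.Ioo (1 : ℝ) 2)
    (hreg : ∀ l : ℝ, 0 < l → Tendsto (fun t => μ.real (Set.Ioi (l * t)) / μ.real (Set.Ioi t)) atTop
      (𝓝 (l ^ (-α)))) :
    Tendsto (fun t => psiRemainder μ t / μ.real (Set.Ioi t)) atTop
      (𝓝 (-(π * α / sin (π * α)))) := by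
  have hanti : Antitone fun t => μ.real (Set.Ioi t) := fun a b hab =>
    measureReal_mono (Set.Ioi_subset_Ioi hab)
  have h := tendsto_integral_kernel_mul hanti hpos (fun t => measureReal_le_one) hα hreg
  rw [integral_kernel_mul_rpow hα (integrableOn_kernel_mul_rpow hα)] at h
  refine h.congr' ?_
  filter_upwards [eventually_gt_atTop 0] with t ht
  rw [psiRemainder_eq_integral_tail hsupp ht, ← integral_div]
  simp_rw [mul_div_assoc]

end Remainder

section WeightedMap

variable {ν : Measure ℝ} {V w f : ℝ → ℝ}

theorem integral_map_withDensity_ofReal (hV : Measurable V) (hw : Measurable w)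
    (hw0 : ∀ᵐ x ∂ν, 0 ≤ w x) (hf : Measurable f) :
    ∫ v, f v ∂((ν.withDensity fun x => ENNReal.ofReal (w x)).map V) = ∫ x, w x * f (V x) ∂ν := by
  rw [integral_map hV.aemeasurable hf.aestronglyMeasurable,
    integral_withDensity_eq_integral_toReal_smul (by fun_prop) (by simp)]
  refine integral_congr_ae (hw0.mono fun x hx => ?_)
  simp only [ENNReal.toReal_ofReal hx, smul_eq_mul]

theorem map_withDensity_ofReal_univ_le_one (hV : Measurable V) (hwi : Integrable w ν)
    (hw0 : ∀ᵐ x ∂ν, 0 ≤ w x) (h1 : ∫ x, w x ∂ν ≤ 1) :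
    ((ν.withDensity fun x => ENNReal.ofReal (w x)).map V) Set.univ ≤ 1 := by
  rw [Measure.map_apply hV .univ, Set.preimage_univ, withDensity_apply _ .univ,
    Measure.restrict_univ, ← ofReal_integral_eq_lintegral_ofReal hwi hw0]
  exact ENNReal.ofReal_le_one.2 h1

theorem ae_map_withDensity_ofReal (hV : Measurable V) {s : Set ℝ} (hs : MeasurableSet s)
    (h : ∀ᵐ x ∂ν, V x ∈ s) :
    ∀ᵐ v ∂((ν.withDensity fun x => ENNReal.ofReal (w x)).map V), v ∈ s :=
  (ae_map_iff hV.aemeasurable hs).2 ((withDensity_absolutelyContinuous ν _).ae_le h)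

end WeightedMap

theorem one_div_one_add_mem_Icc {u : ℝ} (hu : 0 ≤ u) : 1 / (1 + u) ∈ Set.Icc (0 : ℝ) 1 :=
  ⟨by positivity, by rw [div_le_one (by positivity)]; linarith⟩

theorem indicator_Iio_half_one_div_one_add {u : ℝ} (hu : 0 ≤ u) :
    (Set.Iio (1 / 2 : ℝ)).indicator (fun v => v / max (1 - v) (1 / 4) ^ 2) (1 / (1 + u)) =
      (Set.Ioi (1 : ℝ)).indicator (fun u => (1 + u) / u ^ 2) u := by
  rcases le_or_gt u 1 with h | h
  · rw [Set.indicator_of_notMem, Set.indicator_of_notMem (by simpa using h)]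
    rw [Set.mem_Iio, not_lt, div_le_div_iff₀ (by norm_num) (by positivity)]
    linarith
  · have h1 : 1 / (1 + u) < 1 / 2 := by
      rw [div_lt_div_iff₀ (by positivity) (by norm_num)]
      linarith
    rw [Set.indicator_of_mem (Set.mem_Iio.2 h1), Set.indicator_of_mem (Set.mem_Ioi.2 h),
      max_eq_left (by linarith)]
    have h2 : 1 - 1 / (1 + u) = u / (1 + u) := by field_simp; ring
    rw [h2]
    field_simp

/-- A regularly varying remainder determines the asymptotics of the tail. -/
theorem tendsto_tail_div_psiRemainder {μ : Measure ℝ} [IsProbabilityMeasure μ]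
    (hsupp : ∀ᵐ x ∂μ, 0 ≤ x)
    (hm1 : Integrable (fun t : ℝ => t) μ) (hpos : ∀ᶠ t in atTop, 0 < psiRemainder μ t)
    {α : ℝ} (hα : α ∈ Set.Ioo (1 : ℝ) 2)
    (hreg : ∀ l : ℝ, 0 < l → Tendsto (fun t => psiRemainder μ (l * t) / psiRemainder μ t) atTop
      (𝓝 (l ^ (-α)))) :
    Tendsto (fun t => μ.real (Set.Ioi t) / psiRemainder μ t) atTop
      (𝓝 (-(sin (π * α) / (π * α)))) := by
  obtain ⟨hα1, hα2⟩ := hα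
  set κ : ℝ := -(sin (π * α) / π) with hκ
  have hsin : sin (π * α) < 0 := by
    have : 0 < sin (π * α - π) :=
      sin_pos_of_pos_of_lt_pi (by nlinarith [pi_pos]) (by nlinarith [pi_pos])
    rw [sin_sub_pi] at this
    linarith
  have hκ0 : 0 < κ := by
    rw [hκ, neg_pos]
    exact div_neg_of_neg_of_pos hsin pi_pos
  have hκ1 : π / sin (π * (2 - α)) = κ⁻¹ := by
    rw [show π * (2 - α) = 2 * π - π * α by ring, sin_two_pi_sub, hκ, ← neg_div, inv_div]
  have hs0 : 0 < 2 - α := by linarith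
  have hs1 : 2 - α < 1 := by linarith
  set V : ℝ → ℝ → ℝ := fun t x => 1 / (1 + x / t)
  set W : ℝ → ℝ → ℝ := fun t x => (x / t) ^ 2 / (1 + x / t) / psiRemainder μ t
  set V₀ : ℝ → ℝ := fun u => 1 / (1 + u)
  set W₀ : ℝ → ℝ := fun u => κ * (u ^ (2 - α - 1) / (1 + u))
  have hV : ∀ t, Measurable (V t) := fun t => by fun_prop
  have hW : ∀ t, Measurable (W t) := fun t => by fun_prop
  have hV₀ : Measurable V₀ := by fun_prop
  have hW₀ : Measurable W₀ := by fun_prop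
  have hWnn : ∀ t > 0, ∀ᵐ x ∂μ, 0 ≤ W t x := fun t ht => hsupp.mono fun x hx =>
    div_nonneg (by positivity) (psiRemainder_nonneg hsupp ht)
  have hmem : ∀ᵐ u ∂volume.restrict (Set.Ioi (0 : ℝ)), (0 : ℝ) < u :=
    ae_restrict_mem measurableSet_Ioi
  have hW₀nn : ∀ᵐ u ∂volume.restrict (Set.Ioi (0 : ℝ)), 0 ≤ W₀ u := hmem.mono fun u hu => by
    simp only [W₀]
    positivity
  set σ : ℝ → Measure ℝ := fun t => (μ.withDensity fun x => ENNReal.ofReal (W t x)).map (V t)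
  set τ : Measure ℝ :=
    ((volume.restrict (Set.Ioi (0 : ℝ))).withDensity fun u => ENNReal.ofReal (W₀ u)).map V₀
  have hσ1 : ∀ᶠ t in atTop, σ t Set.univ ≤ 1 := by
    filter_upwards [hpos, eventually_gt_atTop 0] with t h0 ht
    refine map_withDensity_ofReal_univ_le_one (hV t)
      ((integrable_psiRemainder hsupp hm1 ht).div_const _) (hWnn t ht) ?_
    rw [integral_div]
    exact (div_self h0.ne').le
  have hτ1 : τ Set.univ ≤ 1 := by
    refine map_withDensity_ofReal_univ_le_one hV₀
      ((integrableOn_rpow_div_one_add hs0 hs1).const_mul κ) hW₀nn ?_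
    rw [integral_const_mul, integral_rpow_div_one_add hs0 hs1, hκ1, mul_inv_cancel₀ hκ0.ne']
  have hσ : ∀ᶠ t in atTop, ∀ᵐ v ∂σ t, v ∈ Set.Icc (0 : ℝ) 1 := by
    filter_upwards [eventually_gt_atTop 0] with t ht
    exact ae_map_withDensity_ofReal (hV t) measurableSet_Icc
      (hsupp.mono fun x hx => one_div_one_add_mem_Icc (div_nonneg hx ht.le))
  have hτ : ∀ᵐ v ∂τ, v ∈ Set.Icc (0 : ℝ) 1 :=
    ae_map_withDensity_ofReal hV₀ measurableSet_Icc
      (hmem.mono fun u hu => one_div_one_add_mem_Icc hu.le)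
  have hlim : ∀ f : ℝ → ℝ, Continuous f →
      Tendsto (fun t => ∫ v, f v ∂σ t) atTop (𝓝 (∫ v, f v ∂τ)) := by
    intro f hf
    refine tendsto_integral_of_tendsto_stieltjes hσ1 hσ hτ1 hτ (fun s hs => ?_) hf
    have hl : 0 < 1 + s := by linarith
    have h1 : ∫ v, 1 / (1 + s * v) ∂τ = (1 + s) * (1 + s) ^ (-α) := by
      rw [integral_map_withDensity_ofReal hV₀ hW₀ hW₀nn (by fun_prop)]
      calc _ = ∫ u in Set.Ioi (0 : ℝ), κ * (u ^ (2 - α - 1) / ((1 + s) + u)) := by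
            refine setIntegral_congr_fun measurableSet_Ioi fun u hu => ?_
            have hu : 0 < u := hu
            simp only [W₀, V₀]
            have h2 : 1 + s * (1 / (1 + u)) = (1 + s + u) / (1 + u) := by field_simp; ring
            rw [h2]
            field_simp
        _ = _ := by
            rw [integral_const_mul, integral_rpow_div_add hs0 hs1 hl, hκ1,
              show 2 - α - 1 = 1 + -α by ring, rpow_add hl, rpow_one]
            field_simp
    rw [h1]
    refine ((hreg (1 + s) hl).const_mul (1 + s)).congr' ?_
    filter_upwards [eventually_gt_atTop 0] with t ht
    rw [integral_map_withDensity_ofReal (hV t) (hW t) (hWnn t ht) (by fun_prop), psiRemainder,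
      ← integral_div, ← integral_const_mul]
    refine integral_congr_ae (hsupp.mono fun x hx => ?_)
    simp only [W, V]
    have h2 : 1 + s * (1 / (1 + x / t)) = ((1 + s) * t + x) / (t + x) := by field_simp; ring
    have h3 : 1 + x / t = (t + x) / t := by field_simp
    have h4 : 1 + x / ((1 + s) * t) = ((1 + s) * t + x) / ((1 + s) * t) := by field_simp
    rw [h2, h3, h4]
    field_simp
  have hw : Continuous fun v : ℝ => v / max (1 - v) (1 / 4) ^ 2 :=
    Continuous.div (by fun_prop) (by fun_prop) fun v => by
      have : (0 : ℝ) < max (1 - v) (1 / 4) := lt_max_of_lt_right (by norm_num)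
      positivity
  have hhalf : τ {1 / 2} = 0 := by
    have : ∀ᵐ u ∂volume.restrict (Set.Ioi (0 : ℝ)), V₀ u ∈ ({1 / 2}ᶜ : Set ℝ) := by
      have h1 : ∀ᵐ u ∂volume.restrict (Set.Ioi (0 : ℝ)), u ≠ 1 :=
        ae_restrict_of_ae (Measure.ae_ne volume 1)
      filter_upwards [hmem, h1] with u hu hu1 h
      refine hu1 ?_
      rw [Set.mem_singleton_iff, div_eq_div_iff (by positivity) (by norm_num)] at h
      linarith
    have := ae_map_withDensity_ofReal (w := W₀) hV₀ (measurableSet_singleton _).compl this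
    exact compl_mem_ae_iff.1 this
  have hmain := tendsto_integral_indicator_Iio hσ1 hσ hτ1 hτ hlim hw
    (fun v hv => div_nonneg hv.1 (by positivity)) hhalf
  have hI : ∫ v, (Set.Iio (1 / 2 : ℝ)).indicator (fun v => v / max (1 - v) (1 / 4) ^ 2) v ∂τ =
      -(sin (π * α) / (π * α)) := by
    rw [integral_map_withDensity_ofReal hV₀ hW₀ hW₀nn
      (hw.measurable.indicator measurableSet_Iio)]
    calc _ = ∫ u in Set.Ioi (0 : ℝ),
          (Set.Ioi (1 : ℝ)).indicator (fun u => κ * u ^ (-α - 1)) u := by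
          refine setIntegral_congr_fun measurableSet_Ioi fun u hu => ?_
          have hu : 0 < u := hu
          simp only [W₀, V₀]
          rw [indicator_Iio_half_one_div_one_add hu.le]
          by_cases h : u ∈ Set.Ioi (1 : ℝ)
          · rw [Set.indicator_of_mem h, Set.indicator_of_mem h,
              show 2 - α - 1 = 2 + (-α - 1) by ring, rpow_add hu]
            norm_num
            field_simp
          · rw [Set.indicator_of_notMem h, Set.indicator_of_notMem h, mul_zero]
      _ = κ / α := by
          rw [setIntegral_indicator measurableSet_Ioi, Set.Ioi_inter_Ioi,
            sup_eq_right.2 zero_le_one, integral_const_mul,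
            integral_Ioi_rpow_of_lt (by linarith) one_pos, one_rpow]
          rw [show -α - 1 + 1 = -α by ring, neg_div_neg_eq, mul_one_div]
      _ = _ := by
          rw [hκ, neg_div, div_div]
  rw [hI] at hmain
  refine hmain.congr' ?_
  filter_upwards [eventually_gt_atTop 0] with t ht
  rw [integral_map_withDensity_ofReal (hV t) (hW t) (hWnn t ht)
      (hw.measurable.indicator measurableSet_Iio)]
  calc _ = ∫ x, (Set.Ioi t).indicator (fun _ => 1 / psiRemainder μ t) x ∂μ := by
        refine integral_congr_ae (hsupp.mono fun x hx => ?_)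
        simp only [W, V]
        rw [indicator_Iio_half_one_div_one_add (div_nonneg hx ht.le)]
        by_cases h : t < x
        · have hx0 : 0 < x := ht.trans h
          rw [Set.indicator_of_mem (Set.mem_Ioi.2 h),
            Set.indicator_of_mem (Set.mem_Ioi.2 ((one_lt_div ht).2 h))]
          field_simp
        · rw [Set.indicator_of_notMem (show x / t ∉ Set.Ioi 1 from mt (one_lt_div ht).1 h),
            Set.indicator_of_notMem, mul_zero]
          exact h
    _ = _ := by
        rw [integral_indicator measurableSet_Ioi, setIntegral_const, smul_eq_mul, mul_one_div]

theorem tendsto_comp_mul_div_of_tendsto_div {F ℓ : ℝ → ℝ} {c α : ℝ} (hc : c ≠ 0)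
    (hℓ : ∀ᶠ t in atTop, ℓ t ≠ 0) (hF : Tendsto (fun t => F t / ℓ t) atTop (𝓝 c)) {l : ℝ}
    (hl : 0 < l) (hreg : Tendsto (fun t => ℓ (l * t) / ℓ t) atTop (𝓝 (l ^ (-α)))) :
    Tendsto (fun t => F (l * t) / F t) atTop (𝓝 (l ^ (-α))) := by
  have hlt : Tendsto (fun t : ℝ => l * t) atTop atTop := tendsto_id.const_mul_atTop hl
  have h := ((hF.comp hlt).mul hreg).div hF hc
  rw [mul_div_cancel_left₀ _ hc] at h
  refine h.congr' ?_
  filter_upwards [hℓ, hlt.eventually hℓ] with t h1 h2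
  simp only [Pi.div_apply, Function.comp_apply]
  rw [div_mul_div_cancel₀ h2, div_div_div_cancel_right₀ h1]

/-- Tauberian theorem for `α ∈ (1,2)`: for a probability measure `μ` on `[0,∞)` with
finite first moment and a slowly varying `L`, the tail `μ((t,∞)) ~ L(t)/t^α` holds iff
`-ψ_μ(-1/t) = m₁(μ)/t + (πα / sin(πα)) (L(t)/t^α)(1+o(1))` as `t → +∞`. -/
theorem tauberian_one_two
    (μ : Measure ℝ) [IsProbabilityMeasure μ] (hsupp : μ (Set.Iio 0) = 0)
    (hm1 : Integrable (fun t : ℝ => t) μ)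
    (L : ℝ → ℝ) (hLpos : ∀ t : ℝ, 0 < t → 0 < L t) (hL : SlowlyVarying L)
    (α : ℝ) (hα : α ∈ Set.Ioo (1 : ℝ) 2) :
    Tendsto (fun t : ℝ => (μ (Set.Ioi t)).toReal / (L t / t ^ α)) atTop (𝓝 1) ↔
      Tendsto (fun t : ℝ =>
        (-psi μ (-1 / t) - (∫ x, x ∂μ) / t) / (L t / t ^ α))
        atTop (𝓝 (π * α / Real.sin (π * α))) := by
  have hs : ∀ᵐ x ∂μ, 0 ≤ x := by
    refine (measure_eq_zero_iff_ae_notMem.1 hsupp).mono fun x hx => ?_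
    simpa using hx
  have hsin : sin (π * α) < 0 := by
    have : 0 < sin (π * α - π) :=
      sin_pos_of_pos_of_lt_pi (by nlinarith [pi_pos, hα.1]) (by nlinarith [pi_pos, hα.2])
    rw [sin_sub_pi] at this
    linarith
  have hα0 : 0 < α := by linarith [hα.1]
  set c : ℝ := -(π * α / sin (π * α)) with hc
  have hc0 : 0 < c := by
    rw [hc, neg_pos]
    exact div_neg_of_pos_of_neg (by positivity) hsin
  have hcinv : -(sin (π * α) / (π * α)) = c⁻¹ := by
    rw [hc, inv_neg, inv_div]
  set ℓ : ℝ → ℝ := fun t => L t / t ^ α with hℓ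
  have hℓpos : ∀ t > 0, 0 < ℓ t := fun t ht => div_pos (hLpos t ht) (by positivity)
  have hℓne : ∀ᶠ t in atTop, ℓ t ≠ 0 :=
    (eventually_gt_atTop 0).mono fun t ht => (hℓpos t ht).ne'
  have hℓreg : ∀ l : ℝ, 0 < l → Tendsto (fun t => ℓ (l * t) / ℓ t) atTop (𝓝 (l ^ (-α))) := by
    intro l hl
    have h := (hL l hl).mul_const (l ^ (-α))
    rw [one_mul] at h
    refine h.congr' ?_
    filter_upwards [eventually_gt_atTop 0] with t ht
    simp only [hℓ]
    rw [mul_rpow hl.le ht.le, rpow_neg hl.le]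
    have := hLpos t ht
    field_simp
  have hR : Tendsto (fun t : ℝ => (-psi μ (-1 / t) - (∫ x, x ∂μ) / t) / (L t / t ^ α))
      atTop (𝓝 (π * α / Real.sin (π * α))) ↔
      Tendsto (fun t => psiRemainder μ t / ℓ t) atTop (𝓝 c) := by
    rw [hc, ← tendsto_neg_iff]
    refine tendsto_congr' ?_
    filter_upwards [eventually_gt_atTop 0] with t ht
    rw [neg_psi_sub_eq hs hm1 ht, neg_div, neg_neg]
  rw [hR]
  change Tendsto (fun t => μ.real (Set.Ioi t) / ℓ t) atTop (𝓝 1) ↔ _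
  constructor
  · intro h
    have hpos : ∀ t, 0 < μ.real (Set.Ioi t) := by
      intro t
      obtain ⟨x, hx, hx0, hxt⟩ := ((h.eventually_const_lt one_pos).and
        ((eventually_gt_atTop 0).and (eventually_ge_atTop t))).exists
      have h1 := (div_pos_iff_of_pos_right (hℓpos x hx0)).1 hx
      exact h1.trans_le (measureReal_mono (Set.Ioi_subset_Ioi hxt))
    have h2 := tendsto_psiRemainder_div_tail hs hpos hα fun l hl =>
      tendsto_comp_mul_div_of_tendsto_div (F := fun t => μ.real (Set.Ioi t)) one_ne_zero hℓne h hl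
        (hℓreg l hl)
    have h3 := h2.mul h
    rw [mul_one] at h3
    exact h3.congr fun t => div_mul_div_cancel₀ (hpos t).ne'
  · intro h
    have hpos : ∀ᶠ t in atTop, 0 < psiRemainder μ t := by
      filter_upwards [h.eventually_const_lt hc0, eventually_gt_atTop 0] with t h1 h2
      exact (div_pos_iff_of_pos_right (hℓpos t h2)).1 h1
    have h2 := tendsto_tail_div_psiRemainder hs hm1 hpos hα fun l hl =>
      tendsto_comp_mul_div_of_tendsto_div hc0.ne' hℓne h hl (hℓreg l hl)
    have h3 := h2.mul h
    rw [hcinv, inv_mul_cancel₀ hc0.ne'] at h3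
    refine h3.congr' ?_
    filter_upwards [hpos] with t ht using div_mul_div_cancel₀ ht.ne'
end

section
/- Let μ be a symmetric Borel probability measure on ℝ, let L : (0,∞) → (0,∞) be slowly varying, and let α ∈ (0,2). Then μ((t,∞)) ~ L(t)/(2 t^α) as t → +∞ if and only if −ψ_μ(−1/(i t)) ~ ((πα/2)/sin(πα/2)) · L(t)/t^α as t → +∞; here −1/(i t) = i/t, ψ_μ(i/t) = ∫ (i x/t)/(1 − i x/t) dμ(x) is real-valued by the symmetry of μ. -/
open MeasureTheory Filter Topology Real

/-- The moment transform `ψ_μ(z) = ∫ z x / (1 - z x) dμ(x)` of a measure on `ℝ`,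
evaluated at a complex argument. -/
noncomputable def psiC (μ : Measure ℝ) (z : ℂ) : ℂ :=
  ∫ x, z * (x : ℂ) / (1 - z * (x : ℂ)) ∂μ

/-- The transform `∫ x² / (x² + t²) dν(x)`, which equals `-Re ψ_ν(i/t)`. -/
noncomputable def stieltjesSq (ν : Measure ℝ) (t : ℝ) : ℝ :=
  ∫ x, x ^ 2 / (x ^ 2 + t ^ 2) ∂ν

/-- The measure of the two-sided tail `{|x| > r}`. -/
noncomputable def absTail (ν : Measure ℝ) (r : ℝ) : ℝ :=
  ν.real {x | r < |x|}

theorem measurable_sq_div_add_sq (t : ℝ) : Measurable fun x : ℝ => x ^ 2 / (x ^ 2 + t ^ 2) := by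
  fun_prop

theorem sq_div_add_sq_nonneg (x t : ℝ) : 0 ≤ x ^ 2 / (x ^ 2 + t ^ 2) := by positivity

theorem sq_div_add_sq_le_one (x t : ℝ) : x ^ 2 / (x ^ 2 + t ^ 2) ≤ 1 :=
  div_le_one_of_le₀ (by nlinarith [sq_nonneg t]) (by positivity)

theorem re_neg_psiC (μ : Measure ℝ) [IsProbabilityMeasure μ] {t : ℝ} (ht : 0 < t) :
    (-(psiC μ (Complex.I / (t : ℂ)))).re = stieltjesSq μ t := by
  have key : ∀ x : ℝ, Complex.I / (t : ℂ) * (x : ℂ) / (1 - Complex.I / (t : ℂ) * (x : ℂ)) =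
      ((-(x ^ 2 / (x ^ 2 + t ^ 2)) : ℝ) : ℂ) + ((t * x / (x ^ 2 + t ^ 2) : ℝ) : ℂ) * Complex.I := by
    intro x
    have htc : (t : ℂ) ≠ 0 := by exact_mod_cast ht.ne'
    have h1 : (t : ℂ) - Complex.I * x ≠ 0 := by
      intro h
      have := congrArg Complex.re h
      simp at this
      exact ht.ne' this
    have h2 : (x : ℂ) ^ 2 + (t : ℂ) ^ 2 ≠ 0 := by
      have : x ^ 2 + t ^ 2 ≠ 0 := by positivity
      exact_mod_cast this
    have h3 : Complex.I / (t : ℂ) * (x : ℂ) / (1 - Complex.I / (t : ℂ) * (x : ℂ)) =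
        Complex.I * x / (t - Complex.I * x) := by
      have h4 : 1 - Complex.I / (t : ℂ) * (x : ℂ) = (t - Complex.I * x) / t := by field_simp
      rw [h4]
      field_simp
    rw [h3]
    push_cast
    rw [div_eq_iff h1]
    field_simp
    linear_combination ((t : ℂ) * x ^ 2) * Complex.I_sq
  have hint : Integrable
      (fun x : ℝ => Complex.I / (t : ℂ) * (x : ℂ) / (1 - Complex.I / (t : ℂ) * (x : ℂ))) μ := by
    simp_rw [key]
    have hI : Integrable (fun x : ℝ => -(x ^ 2 / (x ^ 2 + t ^ 2))) μ := by
      refine Integrable.of_bound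
        (measurable_sq_div_add_sq t).neg.aestronglyMeasurable 1 (Eventually.of_forall fun x => ?_)
      rw [norm_neg, Real.norm_of_nonneg (sq_div_add_sq_nonneg x t)]
      exact sq_div_add_sq_le_one x t
    have hJ : Integrable (fun x : ℝ => t * x / (x ^ 2 + t ^ 2)) μ := by
      refine Integrable.of_bound
        (by fun_prop : Measurable fun x : ℝ => t * x / (x ^ 2 + t ^ 2)).aestronglyMeasurable 1
        (Eventually.of_forall fun x => ?_)
      rw [Real.norm_eq_abs, abs_div, abs_of_pos (by positivity : 0 < x ^ 2 + t ^ 2)]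
      refine div_le_one_of_le₀ (abs_le.2 ⟨?_, ?_⟩) (by positivity)
      · nlinarith [sq_nonneg (x + t)]
      · nlinarith [sq_nonneg (x - t)]
    exact hI.ofReal.add (hJ.ofReal.mul_const _)
  rw [psiC, Complex.neg_re, ← RCLike.re_eq_complex_re, ← integral_re hint, stieltjesSq,
    ← integral_neg]
  refine integral_congr_ae (Eventually.of_forall fun x => ?_)
  simp only [key, RCLike.re_eq_complex_re, Complex.add_re, Complex.re_ofReal_mul, Complex.I_re,
    mul_zero, add_zero, Complex.ofReal_re, neg_neg]

theorem lt_sq_div_add_sq_iff {t v : ℝ} (ht : 0 < t) (hv : v ∈ Set.Ioo (0 : ℝ) 1) (x : ℝ) :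
    v < x ^ 2 / (x ^ 2 + t ^ 2) ↔ t * √(v / (1 - v)) < |x| := by
  have h1 : 0 < 1 - v := sub_pos.2 hv.2
  rw [lt_div_iff₀ (by positivity), ← abs_of_pos ht, ← Real.sqrt_sq_eq_abs t,
    ← Real.sqrt_mul (sq_nonneg t), ← Real.sqrt_sq_eq_abs x, Real.sqrt_lt_sqrt_iff
    (mul_nonneg (sq_nonneg t) (div_nonneg hv.1.le h1.le)), ← mul_div_assoc, div_lt_iff₀ h1,
    Real.sqrt_sq_eq_abs, sq_abs]
  constructor <;> intro h <;> linarith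

theorem lintegral_sq_div_add_sq (ν : Measure ℝ) {t : ℝ} (ht : 0 < t) :
    ∫⁻ x, ENNReal.ofReal (x ^ 2 / (x ^ 2 + t ^ 2)) ∂ν =
      ∫⁻ v in Set.Ioo (0 : ℝ) 1, ν {x | t * √(v / (1 - v)) < |x|} := by
  rw [lintegral_eq_lintegral_meas_lt ν (Eventually.of_forall fun x => sq_div_add_sq_nonneg x t)
    (measurable_sq_div_add_sq t).aemeasurable, ← Set.Ioo_union_Ici_eq_Ioi (zero_lt_one (α := ℝ)),
    lintegral_union measurableSet_Ici (Set.disjoint_left.2 fun v h h' => not_lt.2 h' h.2),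
    setLIntegral_congr_fun (g := fun _ => 0) measurableSet_Ici, lintegral_zero, add_zero]
  · refine setLIntegral_congr_fun measurableSet_Ioo fun v hv => ?_
    simp only [lt_sq_div_add_sq_iff ht hv]
  · intro v hv
    have : {x : ℝ | v < x ^ 2 / (x ^ 2 + t ^ 2)} = ∅ :=
      Set.eq_empty_of_forall_notMem fun x hx =>
        absurd (lt_of_lt_of_le hx (sq_div_add_sq_le_one x t)) (not_lt.2 hv)
    simp [this]

theorem stieltjesSq_eq_toReal (ν : Measure ℝ) (t : ℝ) :
    stieltjesSq ν t = (∫⁻ x, ENNReal.ofReal (x ^ 2 / (x ^ 2 + t ^ 2)) ∂ν).toReal :=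
  integral_eq_lintegral_of_nonneg_ae (Eventually.of_forall fun x => sq_div_add_sq_nonneg x t)
    (measurable_sq_div_add_sq t).aestronglyMeasurable

theorem antitone_absTail (μ : Measure ℝ) [IsFiniteMeasure μ] : Antitone (absTail μ) :=
  fun _ _ hrs => measureReal_mono fun _ hx => lt_of_le_of_lt hrs hx

theorem stieltjesSq_eq_integral_absTail (μ : Measure ℝ) [IsFiniteMeasure μ] {t : ℝ} (ht : 0 < t) :
    stieltjesSq μ t = ∫ v in Set.Ioo (0 : ℝ) 1, absTail μ (t * √(v / (1 - v))) := by
  rw [stieltjesSq_eq_toReal, lintegral_sq_div_add_sq μ ht]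
  simp only [absTail, Measure.real]
  rw [integral_toReal]
  · have hm : Measurable fun r : ℝ => μ {x | r < |x|} :=
      Antitone.measurable fun _ _ hrs => measure_mono fun _ hx => lt_of_le_of_lt hrs hx
    exact (hm.comp (by fun_prop : Measurable fun v : ℝ => t * √(v / (1 - v)))).aemeasurable
  · exact Eventually.of_forall fun v => measure_lt_top _ _

theorem lintegral_odds_rpow_neg {a : ℝ} (ha : a ∈ Set.Ioo (0 : ℝ) 1) :
    ∫⁻ v in Set.Ioo (0 : ℝ) 1, ENNReal.ofReal ((v / (1 - v)) ^ (-a)) =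
      ENNReal.ofReal (π * a / Real.sin (π * a)) := by
  obtain ⟨ha0, ha1⟩ := ha
  have h1a : 0 < 1 - a := by linarith
  have hb : ProbabilityTheory.beta (1 - a) (1 + a) = π * a / Real.sin (π * a) := by
    have h2 : (1 - a) + (1 + a) = 2 := by ring
    rw [ProbabilityTheory.beta, h2, Real.Gamma_two, add_comm 1 a, Real.Gamma_add_one ha0.ne']
    have := Real.Gamma_mul_Gamma_one_sub a
    rw [div_one, mul_div_right_comm, ← this]
    ring
  have hpos : 0 < ProbabilityTheory.beta (1 - a) (1 + a) :=
    ProbabilityTheory.beta_pos h1a (by linarith)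
  have h1 := ProbabilityTheory.lintegral_betaPDF_eq_one h1a (by linarith : 0 < 1 + a)
  rw [ProbabilityTheory.lintegral_betaPDF] at h1
  have h2 : ∀ v ∈ Set.Ioo (0 : ℝ) 1, ENNReal.ofReal ((v / (1 - v)) ^ (-a)) =
      ENNReal.ofReal (ProbabilityTheory.beta (1 - a) (1 + a)) *
        ENNReal.ofReal (1 / ProbabilityTheory.beta (1 - a) (1 + a) *
          v ^ ((1 - a) - 1) * (1 - v) ^ ((1 + a) - 1)) := by
    intro v hv
    have hv1 : 0 < 1 - v := sub_pos.2 hv.2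
    rw [← ENNReal.ofReal_mul hpos.le, Real.div_rpow hv.1.le hv1.le, Real.rpow_neg hv1.le,
      div_inv_eq_mul]
    congr 1
    rw [show (1 - a) - 1 = -a by ring, show (1 + a) - 1 = a by ring]
    field_simp
  rw [setLIntegral_congr_fun measurableSet_Ioo h2, lintegral_const_mul' _ _ ENNReal.ofReal_ne_top,
    h1, mul_one, hb]

theorem integrableOn_odds_rpow_neg {a : ℝ} (ha : a ∈ Set.Ioo (0 : ℝ) 1) :
    IntegrableOn (fun v : ℝ => (v / (1 - v)) ^ (-a)) (Set.Ioo 0 1) := by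
  refine ⟨(by fun_prop : Measurable fun v : ℝ => (v / (1 - v)) ^ (-a)).aestronglyMeasurable, ?_⟩
  rw [hasFiniteIntegral_iff_ofReal, lintegral_odds_rpow_neg ha]
  · exact ENNReal.ofReal_lt_top
  · exact (ae_restrict_mem measurableSet_Ioo).mono fun v hv =>
      Real.rpow_nonneg (div_nonneg hv.1.le (sub_pos.2 hv.2).le) _

theorem integral_odds_rpow_neg {a : ℝ} (ha : a ∈ Set.Ioo (0 : ℝ) 1) :
    ∫ v in Set.Ioo (0 : ℝ) 1, (v / (1 - v)) ^ (-a) = π * a / Real.sin (π * a) := by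
  rw [integral_eq_lintegral_of_nonneg_ae _ (integrableOn_odds_rpow_neg ha).aestronglyMeasurable,
    lintegral_odds_rpow_neg ha, ENNReal.toReal_ofReal]
  · have : 0 < Real.sin (π * a) :=
      Real.sin_pos_of_pos_of_lt_pi (mul_pos pi_pos ha.1) (by nlinarith [pi_pos, ha.2])
    have := ha.1.le
    have := pi_pos
    positivity
  · exact (ae_restrict_mem measurableSet_Ioo).mono fun v hv =>
      Real.rpow_nonneg (div_nonneg hv.1.le (sub_pos.2 hv.2).le) _

theorem sqrt_rpow_neg {y : ℝ} (hy : 0 ≤ y) (α : ℝ) : √y ^ (-α) = y ^ (-(α / 2)) := by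
  rw [Real.sqrt_eq_rpow, ← Real.rpow_mul hy]
  congr 1
  ring

theorem tendsto_comp_mul_div_of_slowlyVarying {L : ℝ → ℝ} (hLpos : ∀ t : ℝ, 0 < t → 0 < L t)
    (hL : SlowlyVarying L) {α c : ℝ} {f : ℝ → ℝ}
    (hf : Tendsto (fun t => f t / (L t / t ^ α)) atTop (𝓝 c)) (hc : c ≠ 0) {l : ℝ} (hl : 0 < l) :
    Tendsto (fun t => f (l * t) / f t) atTop (𝓝 (l ^ (-α))) := by
  have h1 : Tendsto (fun t : ℝ => f (l * t) / (L (l * t) / (l * t) ^ α)) atTop (𝓝 c) :=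
    hf.comp (tendsto_id.const_mul_atTop hl)
  have h2 : Tendsto (fun t : ℝ => L (l * t) / L t * l ^ (-α)) atTop (𝓝 (1 * l ^ (-α))) :=
    (hL l hl).mul_const _
  have h3 := (h1.mul h2).div hf hc
  rw [one_mul, mul_div_cancel_left₀ _ hc] at h3
  refine h3.congr' ((eventually_gt_atTop 0).mono fun t ht => ?_)
  have hp1 := (hLpos t ht).ne'
  have hp2 := (hLpos (l * t) (mul_pos hl ht)).ne'
  have hp3 := (Real.rpow_pos_of_pos ht α).ne'
  have hp4 := (Real.rpow_pos_of_pos hl α).ne'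
  simp only [Pi.div_apply]
  rw [Real.mul_rpow hl.le ht.le, Real.rpow_neg hl.le]
  field_simp

/-- A Potter-type bound for a bounded antitone function with `T (2 t) / T t → 2 ^ (-α)`. -/
theorem Antitone.exists_le_mul_one_add_rpow {T : ℝ → ℝ} (hT : Antitone T) (hpos : ∀ t, 0 < T t)
    (hle : ∀ t, T t ≤ 1) {α β : ℝ} (hαβ : α < β) (hβ : 0 < β)
    (h2 : Tendsto (fun t => T (2 * t) / T t) atTop (𝓝 (2 ^ (-α)))) :
    ∃ A > 0, ∃ K, ∀ t ≥ A, ∀ r > 0, T (t * r) ≤ K * (1 + r ^ (-β)) * T t := by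
  have hlt : (2 : ℝ) ^ (-β) < 2 ^ (-α) :=
    Real.rpow_lt_rpow_of_exponent_lt one_lt_two (neg_lt_neg hαβ)
  obtain ⟨A₀, hA₀⟩ := eventually_atTop.1 (h2.eventually (lt_mem_nhds hlt))
  obtain ⟨A, hA₀A, hA⟩ : ∃ A, A₀ ≤ A ∧ 0 < A := ⟨max A₀ 1, le_max_left _ _, by positivity⟩
  have h2β : (0 : ℝ) < 2 ^ β := by positivity
  have hstep : ∀ s ≥ A, T s ≤ 2 ^ β * T (2 * s) := by
    intro s hs
    have h := (lt_div_iff₀ (hpos s)).1 (hA₀ s (hA₀A.trans hs))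
    rw [Real.rpow_neg two_pos.le, inv_mul_lt_iff₀ h2β] at h
    exact h.le
  have hiter : ∀ n : ℕ, ∀ s ≥ A, T s ≤ (2 ^ β) ^ n * T (2 ^ n * s) := by
    intro n
    induction n with
    | zero => intro s _; simp
    | succ n ih =>
      intro s hs
      have hs2 : A ≤ 2 * s := by linarith
      calc T s ≤ 2 ^ β * T (2 * s) := hstep s hs
        _ ≤ 2 ^ β * ((2 ^ β) ^ n * T (2 ^ n * (2 * s))) := by gcongr; exact ih _ hs2
        _ = (2 ^ β) ^ (n + 1) * T (2 ^ (n + 1) * s) := by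
          rw [show (2 : ℝ) ^ n * (2 * s) = 2 ^ (n + 1) * s by ring]; ring
  have hpow : ∀ s t, A ≤ s → s ≤ t → T s ≤ 2 ^ β * (t / s) ^ β * T t := by
    intro s t hs hst
    have hs0 : 0 < s := hA.trans_le hs
    obtain ⟨n, hn1, hn2⟩ := exists_nat_pow_near ((one_le_div hs0).2 hst) one_lt_two
    have hts : t ≤ 2 ^ (n + 1) * s := ((div_lt_iff₀ hs0).1 hn2).le
    have ht : 0 < T t := hpos t
    calc T s ≤ (2 ^ β) ^ (n + 1) * T (2 ^ (n + 1) * s) := hiter _ s hs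
      _ ≤ (2 ^ β) ^ (n + 1) * T t := by gcongr; exact hT hts
      _ = 2 ^ β * ((2 : ℝ) ^ n) ^ β * T t := by
        rw [pow_succ', Real.rpow_pow_comm two_pos.le]
      _ ≤ 2 ^ β * (t / s) ^ β * T t := by gcongr
  have hTA := hpos A
  refine ⟨A, hA, 1 + 2 ^ β * (1 + (T A)⁻¹), fun t ht r hr => ?_⟩
  have ht0 : 0 < t := hA.trans_le ht
  have hTt : 0 < T t := hpos t
  have hrβ : 0 < r ^ (-β) := Real.rpow_pos_of_pos hr _
  have hi : 0 < (T A)⁻¹ := inv_pos.2 hTA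
  rcases le_total 1 r with h1 | h1
  · have h3 : T (t * r) ≤ T t := hT (le_mul_of_one_le_right ht0.le h1)
    have h4 : 1 ≤ (1 + 2 ^ β * (1 + (T A)⁻¹)) * (1 + r ^ (-β)) :=
      one_le_mul_of_one_le_of_one_le (by simp; positivity) (by linarith)
    exact h3.trans (le_mul_of_one_le_left hTt.le h4)
  have hmain : T (t * r) ≤ 2 ^ β * (1 + (T A)⁻¹) * r ^ (-β) * T t := by
    rcases le_total A (t * r) with h3 | h3
    · calc T (t * r) ≤ 2 ^ β * (t / (t * r)) ^ β * T t :=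
            hpow _ _ h3 (mul_le_of_le_one_right ht0.le h1)
        _ = 2 ^ β * 1 * r ^ (-β) * T t := by
          rw [Real.rpow_neg_eq_inv_rpow, div_mul_cancel_left₀ ht0.ne', mul_one]
        _ ≤ 2 ^ β * (1 + (T A)⁻¹) * r ^ (-β) * T t := by gcongr; linarith
    · calc T (t * r) ≤ 1 := hle _
        _ = (T A)⁻¹ * T A := (inv_mul_cancel₀ hTA.ne').symm
        _ ≤ (T A)⁻¹ * (2 ^ β * (t / A) ^ β * T t) := by gcongr; exact hpow _ _ le_rfl ht
        _ ≤ (T A)⁻¹ * (2 ^ β * r ^ (-β) * T t) := by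
          rw [Real.rpow_neg_eq_inv_rpow]
          gcongr
          rw [div_le_iff₀ hA, inv_mul_eq_div, le_div_iff₀ hr]
          exact h3
        _ = 2 ^ β * (T A)⁻¹ * r ^ (-β) * T t := by ring
        _ ≤ 2 ^ β * (1 + (T A)⁻¹) * r ^ (-β) * T t := by gcongr; linarith
  refine hmain.trans ?_
  gcongr <;> linarith

theorem absTail_le_one (μ : Measure ℝ) [IsProbabilityMeasure μ] (r : ℝ) : absTail μ r ≤ 1 :=
  measureReal_le_one

/-- Abelian direction: a regularly varying tail determines the asymptotics of the transform. -/
theorem tendsto_stieltjesSq_div_absTail (μ : Measure ℝ) [IsProbabilityMeasure μ] {α : ℝ}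
    (hα : α ∈ Set.Ioo (0 : ℝ) 2) (hpos : ∀ t, 0 < absTail μ t)
    (h : ∀ l > 0, Tendsto (fun t => absTail μ (l * t) / absTail μ t) atTop (𝓝 (l ^ (-α)))) :
    Tendsto (fun t => stieltjesSq μ t / absTail μ t) atTop
      (𝓝 (π * (α / 2) / Real.sin (π * (α / 2)))) := by
  obtain ⟨β, hαβ, hβ2⟩ := exists_between hα.2
  have hβ0 : 0 < β := hα.1.trans hαβ
  obtain ⟨A, hA, K, hK⟩ := (antitone_absTail μ).exists_le_mul_one_add_rpow hpos
    (absTail_le_one μ) hαβ hβ0 (h 2 two_pos)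
  have hlim : Tendsto
      (fun t => ∫ v in Set.Ioo (0 : ℝ) 1, absTail μ (t * √(v / (1 - v))) / absTail μ t) atTop
      (𝓝 (∫ v in Set.Ioo (0 : ℝ) 1, (v / (1 - v)) ^ (-(α / 2)))) := by
    have hodds : ∀ v ∈ Set.Ioo (0 : ℝ) 1, 0 < v / (1 - v) := fun v hv =>
      div_pos hv.1 (sub_pos.2 hv.2)
    refine tendsto_integral_filter_of_dominated_convergence
      (fun v => K * (1 + (v / (1 - v)) ^ (-(β / 2)))) (Eventually.of_forall fun t => ?_)
      ((eventually_ge_atTop A).mono fun t ht => ?_) ?_ ?_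
    · exact (((antitone_absTail μ).measurable.comp
        (by fun_prop : Measurable fun v : ℝ => t * √(v / (1 - v)))).div_const
          _).aestronglyMeasurable
    · refine (ae_restrict_mem measurableSet_Ioo).mono fun v hv => ?_
      have hv0 := hodds v hv
      rw [Real.norm_of_nonneg (div_nonneg (hpos _).le (hpos _).le), div_le_iff₀ (hpos t),
        ← sqrt_rpow_neg hv0.le]
      exact hK t ht _ (Real.sqrt_pos.2 hv0)
    · exact ((integrable_const _).add
        (integrableOn_odds_rpow_neg ⟨by linarith, by linarith⟩)).const_mul _
    · refine (ae_restrict_mem measurableSet_Ioo).mono fun v hv => ?_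
      have hv0 := hodds v hv
      rw [← sqrt_rpow_neg hv0.le]
      simpa only [mul_comm] using h _ (Real.sqrt_pos.2 hv0)
  rw [integral_odds_rpow_neg ⟨by linarith [hα.1], by linarith [hα.2]⟩] at hlim
  refine hlim.congr' ((eventually_gt_atTop 0).mono fun t ht => ?_)
  simp only [stieltjesSq_eq_integral_absTail μ ht, integral_div]

open scoped unitInterval NNReal

/-- The function `w ↦ 1 / (1 + k w)` on the unit interval. -/
noncomputable def resolventMap (k : ℝ≥0) : C(I, ℝ) where
  toFun w := 1 / (1 + k * (w : ℝ))
  continuous_toFun := by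
    refine continuous_const.div (by fun_prop) fun w => ?_
    have := w.2.1
    positivity

theorem resolventMap_apply (k : ℝ≥0) (w : I) : resolventMap k w = 1 / (1 + k * (w : ℝ)) := rfl

theorem resolventMap_mul_of_ne {k : ℝ≥0} (hk : k ≠ 1) :
    resolventMap 1 * resolventMap k =
      (1 - (k : ℝ))⁻¹ • (resolventMap 1 - (k : ℝ) • resolventMap k) := by
  ext w
  have hw := w.2.1
  have h1 : (1 : ℝ) - k ≠ 0 := sub_ne_zero.2 fun h => hk (by exact_mod_cast h.symm)
  have h2 : (1 : ℝ) + w ≠ 0 := by positivity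
  have h3 : (1 : ℝ) + k * w ≠ 0 := by positivity
  simp only [ContinuousMap.mul_apply, ContinuousMap.smul_apply, ContinuousMap.sub_apply,
    resolventMap_apply, smul_eq_mul, NNReal.coe_one, one_mul]
  field_simp
  ring

theorem continuous_resolventMap : Continuous resolventMap := by
  refine ContinuousMap.continuous_of_continuous_uncurry _ ?_
  change Continuous fun p : ℝ≥0 × I => 1 / (1 + (p.1 : ℝ) * (p.2 : ℝ))
  refine continuous_const.div (by fun_prop) fun p => ?_
  have := p.2.2.1
  positivity

theorem topologicalClosure_span_resolventMap :
    (Submodule.span ℝ (Set.range resolventMap)).topologicalClosure = ⊤ := by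
  set S := Submodule.span ℝ (Set.range resolventMap)
  have hmem : ∀ k, resolventMap k ∈ S := fun k => Submodule.subset_span ⟨k, rfl⟩
  have hne : ∀ k, k ≠ 1 → resolventMap 1 * resolventMap k ∈ S := fun k hk => by
    rw [resolventMap_mul_of_ne hk]
    exact S.smul_mem _ (S.sub_mem (hmem _) (S.smul_mem _ (hmem _)))
  have hgen : ∀ k, resolventMap 1 * resolventMap k ∈ S.topologicalClosure := by
    intro k
    have hd : Dense ({1}ᶜ : Set ℝ≥0) := dense_compl_singleton 1
    have hc : Continuous fun k => resolventMap 1 * resolventMap k :=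
      continuous_const.mul continuous_resolventMap
    have hcl : IsClosed {k | resolventMap 1 * resolventMap k ∈ S.topologicalClosure} :=
      S.isClosed_topologicalClosure.preimage hc
    have hsub : ({1}ᶜ : Set ℝ≥0) ⊆ {k | resolventMap 1 * resolventMap k ∈ S.topologicalClosure} :=
      fun k hk => S.le_topologicalClosure (hne k hk)
    exact hcl.closure_subset_iff.2 hsub (hd k)
  have hspan : ∀ f ∈ S, resolventMap 1 * f ∈ S.topologicalClosure := by
    intro f hf
    induction hf using Submodule.span_induction with
    | mem f hf => obtain ⟨k, rfl⟩ := hf; exact hgen k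
    | zero => simp
    | add f g _ _ hf hg => rw [mul_add]; exact Submodule.add_mem _ hf hg
    | smul c f _ hf => rw [mul_smul_comm]; exact Submodule.smul_mem _ _ hf
  have hclos : ∀ f ∈ S.topologicalClosure, resolventMap 1 * f ∈ S.topologicalClosure := by
    have hcl : IsClosed {f | resolventMap 1 * f ∈ S.topologicalClosure} :=
      S.isClosed_topologicalClosure.preimage (continuous_const.mul continuous_id)
    exact fun f hf => closure_minimal hspan hcl hf
  have hadj : ∀ g ∈ Algebra.adjoin ℝ {resolventMap 1},
      ∀ f ∈ S.topologicalClosure, g * f ∈ S.topologicalClosure := by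
    intro g hg
    induction hg using Algebra.adjoin_induction with
    | mem g hg => rw [Set.mem_singleton_iff.1 hg]; exact hclos
    | algebraMap r =>
      intro f hf
      rw [← Algebra.smul_def]
      exact Submodule.smul_mem _ _ hf
    | add g₁ g₂ _ _ h₁ h₂ =>
      intro f hf
      rw [add_mul]
      exact Submodule.add_mem _ (h₁ f hf) (h₂ f hf)
    | mul g₁ g₂ _ _ h₁ h₂ =>
      intro f hf
      rw [mul_assoc]
      exact h₁ _ (h₂ f hf)
  have hone : (1 : C(I, ℝ)) ∈ S.topologicalClosure := by
    have : resolventMap 0 = 1 := by ext w; simp [resolventMap_apply]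
    exact this ▸ S.le_topologicalClosure (hmem 0)
  have hsep : (Algebra.adjoin ℝ {resolventMap 1}).SeparatesPoints := by
    intro x y hxy
    refine ⟨_, ⟨resolventMap 1, Algebra.subset_adjoin rfl, rfl⟩, fun h => hxy ?_⟩
    have hx := x.2.1
    have hy := y.2.1
    simp only [resolventMap_apply, NNReal.coe_one, one_mul] at h
    rw [div_eq_div_iff (by positivity) (by positivity)] at h
    exact Subtype.ext (by linarith)
  have htop := ContinuousMap.subalgebra_topologicalClosure_eq_top_of_separatesPoints _ hsep
  rw [eq_top_iff]
  intro f _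
  have hf : f ∈ (Algebra.adjoin ℝ {resolventMap 1}).topologicalClosure := htop ▸ trivial
  exact closure_minimal (fun g hg => mul_one g ▸ hadj g hg 1 hone)
    S.isClosed_topologicalClosure hf

/-- Convergence of uniformly bounded linear functionals extends from a set with dense span. -/
theorem tendsto_of_topologicalClosure_span_eq_top {ι E : Type*} [NormedAddCommGroup E]
    [NormedSpace ℝ E] {l : Filter ι} {Λ : ι → E →ₗ[ℝ] ℝ} {M : E →ₗ[ℝ] ℝ}
    (hΛ : ∀ᶠ t in l, ∀ f, |Λ t f| ≤ ‖f‖) (hM : ∀ f, |M f| ≤ ‖f‖) {s : Set E}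
    (hs : (Submodule.span ℝ s).topologicalClosure = ⊤)
    (h : ∀ f ∈ s, Tendsto (fun t => Λ t f) l (𝓝 (M f))) (f : E) :
    Tendsto (fun t => Λ t f) l (𝓝 (M f)) := by
  have hspan : ∀ g ∈ Submodule.span ℝ s, Tendsto (fun t => Λ t g) l (𝓝 (M g)) := by
    intro g hg
    induction hg using Submodule.span_induction with
    | mem g hg => exact h g hg
    | zero => simpa using tendsto_const_nhds
    | add f g _ _ hf hg => simpa using hf.add hg
    | smul c f _ hf => simpa using hf.const_mul c
  rw [Metric.tendsto_nhds]
  intro ε hε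
  have hf : f ∈ closure (Submodule.span ℝ s : Set E) := by
    rw [← Submodule.topologicalClosure_coe, hs]
    trivial
  obtain ⟨g, hg, hfg⟩ := Metric.mem_closure_iff.1 hf (ε / 3) (by positivity)
  filter_upwards [hΛ, Metric.tendsto_nhds.1 (hspan g hg) (ε / 3) (by positivity)] with t ht htg
  have h1 := ht (f - g)
  have h2 := hM (f - g)
  rw [map_sub, ← dist_eq_norm] at h1 h2
  rw [Real.dist_eq] at htg ⊢
  rw [abs_le] at h1 h2
  rw [abs_lt] at htg ⊢
  constructor <;> linarith [h1.1, h1.2, h2.1, h2.2, htg.1, htg.2]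

/-- The point `t² / (x² + t²)` of the unit interval. -/
noncomputable def ratioPoint (t x : ℝ) : I :=
  ⟨t ^ 2 / (x ^ 2 + t ^ 2), by rw [add_comm]; exact sq_div_add_sq_nonneg t x,
    by rw [add_comm]; exact sq_div_add_sq_le_one t x⟩

theorem measurable_ratioPoint (t : ℝ) : Measurable (ratioPoint t) :=
  (by fun_prop : Measurable fun x : ℝ => t ^ 2 / (x ^ 2 + t ^ 2)).subtype_mk

theorem integrable_comp_ratioPoint_mul {ν : Measure ℝ} {t : ℝ}
    (hν : Integrable (fun x => x ^ 2 / (x ^ 2 + t ^ 2)) ν) (f : C(I, ℝ)) :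
    Integrable (fun x => f (ratioPoint t x) * (x ^ 2 / (x ^ 2 + t ^ 2))) ν :=
  hν.bdd_mul (f.continuous.measurable.comp (measurable_ratioPoint t)).aestronglyMeasurable
    (Eventually.of_forall fun _ => f.norm_coe_le_norm _)

/-- The functional `f ↦ ∫ f(t² / (x² + t²)) x² / (x² + t²) dν(x)` on `C([0,1])`. -/
noncomputable def ratioFunctional (ν : Measure ℝ) (t : ℝ)
    (hν : Integrable (fun x => x ^ 2 / (x ^ 2 + t ^ 2)) ν) : C(I, ℝ) →ₗ[ℝ] ℝ where
  toFun f := ∫ x, f (ratioPoint t x) * (x ^ 2 / (x ^ 2 + t ^ 2)) ∂ν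
  map_add' f g := by
    simp only [ContinuousMap.add_apply, add_mul]
    exact integral_add (integrable_comp_ratioPoint_mul hν f) (integrable_comp_ratioPoint_mul hν g)
  map_smul' c f := by
    simp only [ContinuousMap.smul_apply, smul_eq_mul, mul_assoc, RingHom.id_apply]
    exact integral_const_mul _ _

theorem ratioFunctional_apply (ν : Measure ℝ) (t : ℝ)
    (hν : Integrable (fun x => x ^ 2 / (x ^ 2 + t ^ 2)) ν) (f : C(I, ℝ)) :
    ratioFunctional ν t hν f = ∫ x, f (ratioPoint t x) * (x ^ 2 / (x ^ 2 + t ^ 2)) ∂ν := rfl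

theorem abs_ratioFunctional_le (ν : Measure ℝ) (t : ℝ)
    (hν : Integrable (fun x => x ^ 2 / (x ^ 2 + t ^ 2)) ν) (f : C(I, ℝ)) :
    |ratioFunctional ν t hν f| ≤ stieltjesSq ν t * ‖f‖ := by
  rw [ratioFunctional_apply, mul_comm, stieltjesSq, ← integral_const_mul, ← Real.norm_eq_abs]
  refine norm_integral_le_of_norm_le (hν.const_mul _) (Eventually.of_forall fun x => ?_)
  rw [norm_mul, Real.norm_of_nonneg (sq_div_add_sq_nonneg x t)]
  exact mul_le_mul_of_nonneg_right (f.norm_coe_le_norm _) (sq_div_add_sq_nonneg x t)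

theorem ratioFunctional_resolventMap (ν : Measure ℝ) {t : ℝ} (ht : 0 < t)
    (hν : Integrable (fun x => x ^ 2 / (x ^ 2 + t ^ 2)) ν) (k : ℝ≥0) :
    ratioFunctional ν t hν (resolventMap k) = stieltjesSq ν (√(1 + k) * t) := by
  rw [ratioFunctional_apply, stieltjesSq]
  congr 1
  ext x
  have h1 : x ^ 2 + t ^ 2 ≠ 0 := by positivity
  have h2 : x ^ 2 + (1 + k) * t ^ 2 ≠ 0 := by positivity
  have h3 : x ^ 2 + t ^ 2 + k * t ^ 2 ≠ 0 := by positivity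
  rw [mul_pow, Real.sq_sqrt (by positivity), resolventMap_apply]
  simp only [ratioPoint]
  field_simp
  ring

/-- A continuous function whose functional lies between the tails at `r t` and `t`. -/
theorem exists_absTail_le_ratioFunctional_le {r : ℝ} (hr : 1 < r) :
    ∃ f : C(I, ℝ), ∀ (ν : Measure ℝ) (t : ℝ), 0 < t → ν {x | t < |x|} ≠ ⊤ →
      ∀ hν : Integrable (fun x => x ^ 2 / (x ^ 2 + t ^ 2)) ν,
      absTail ν (r * t) ≤ ratioFunctional ν t hν f ∧ ratioFunctional ν t hν f ≤ absTail ν t := by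
  have hr0 : 0 < r := by linarith
  have hw : 0 < (1 : ℝ) / 2 - 1 / (1 + r ^ 2) :=
    sub_pos.2 (one_div_lt_one_div_of_lt two_pos (by nlinarith))
  set δ := (1 : ℝ) / 2 - 1 / (1 + r ^ 2) with hδ
  let f : C(I, ℝ) :=
    { toFun := fun w => max 0 (min 1 ((1 / 2 - (w : ℝ)) / δ)) / max (1 - (w : ℝ)) (1 / 2)
      continuous_toFun := by
        refine Continuous.div (by fun_prop) (by fun_prop) fun w => ?_
        exact (lt_max_of_lt_right (by norm_num)).ne' }
  have hf : ∀ w : I, f w = max 0 (min 1 ((1 / 2 - (w : ℝ)) / δ)) / max (1 - (w : ℝ)) (1 / 2) :=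
    fun w => rfl
  have hkey : ∀ t x : ℝ, 0 < t → f (ratioPoint t x) * (x ^ 2 / (x ^ 2 + t ^ 2)) =
      max 0 (min 1 ((1 / 2 - t ^ 2 / (x ^ 2 + t ^ 2)) / δ)) := by
    intro t x ht
    have h1 : x ^ 2 / (x ^ 2 + t ^ 2) = 1 - t ^ 2 / (x ^ 2 + t ^ 2) := by
      have : x ^ 2 + t ^ 2 ≠ 0 := by positivity
      field_simp
      ring
    rw [h1, hf]
    simp only [ratioPoint]
    rcases le_total (1 / 2) (t ^ 2 / (x ^ 2 + t ^ 2)) with h2 | h2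
    · have h3 : (1 / 2 - t ^ 2 / (x ^ 2 + t ^ 2)) / δ ≤ 0 :=
        div_nonpos_of_nonpos_of_nonneg (by linarith) hw.le
      rw [max_eq_left ((min_le_right _ _).trans h3)]
      simp
    · rw [max_eq_left (b := (1 : ℝ) / 2) (by linarith)]
      exact div_mul_cancel₀ _ (by linarith : (0 : ℝ) < 1 - t ^ 2 / (x ^ 2 + t ^ 2)).ne'
  refine ⟨f, fun ν t ht hfin hν => ?_⟩
  have hms : ∀ s : ℝ, MeasurableSet {x : ℝ | s < |x|} := fun s =>
    measurableSet_lt measurable_const measurable_abs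
  have hfin' : ν {x | r * t < |x|} ≠ ⊤ :=
    ne_top_of_le_ne_top hfin (measure_mono fun _ hx =>
      lt_of_le_of_lt (le_mul_of_one_le_left ht.le hr.le) hx)
  have hint : ∀ s, ν {x | s < |x|} ≠ ⊤ →
      Integrable ({x : ℝ | s < |x|}.indicator fun _ => (1 : ℝ)) ν := fun s hs =>
    (integrable_indicator_iff (hms s)).2 (integrableOn_const hs)
  have htail : ∀ s, absTail ν s = ∫ x, {x : ℝ | s < |x|}.indicator (fun _ => (1 : ℝ)) x ∂ν :=
    fun s => (integral_indicator_one (hms s)).symm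
  have hlt : ∀ s x : ℝ, 0 < s → s < |x| → s ^ 2 < x ^ 2 := fun s x hs hx =>
    sq_lt_sq.2 (by rwa [abs_of_pos hs])
  rw [htail, htail, ratioFunctional_apply]
  constructor
  · refine integral_mono (hint _ hfin') (integrable_comp_ratioPoint_mul hν f) fun x => ?_
    simp only [hkey t x ht]
    by_cases hx : r * t < |x|
    · rw [Set.indicator_of_mem (by exact hx)]
      have h1 := hlt _ x (mul_pos hr0 ht) hx
      refine le_max_of_le_right (le_min le_rfl ?_)
      rw [le_div_iff₀ hw, one_mul, hδ]
      refine sub_le_sub_left ?_ _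
      rw [div_le_div_iff₀ (by positivity) (by positivity)]
      nlinarith
    · rw [Set.indicator_of_notMem (by exact hx)]
      exact le_max_left _ _
  · refine integral_mono (integrable_comp_ratioPoint_mul hν f) (hint _ hfin) fun x => ?_
    simp only [hkey t x ht]
    by_cases hx : t < |x|
    · rw [Set.indicator_of_mem (by exact hx)]
      exact max_le zero_le_one (min_le_left _ _)
    · rw [Set.indicator_of_notMem (by exact hx)]
      have h1 : x ^ 2 ≤ t ^ 2 := sq_le_sq.2 (by rw [abs_of_pos ht]; exact not_lt.1 hx)
      refine max_le le_rfl ((min_le_right _ _).trans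
        (div_nonpos_of_nonpos_of_nonneg (sub_nonpos.2 ?_) hw.le))
      rw [div_le_div_iff₀ two_pos (by positivity)]
      linarith

/-- The measure on `(0, ∞)` with density `α x ^ (-α - 1)`, whose tail is `r ^ (-α)`. -/
noncomputable def powerMeasure (α : ℝ) : Measure ℝ :=
  (volume.restrict (Set.Ioi 0)).withDensity fun x => ENNReal.ofReal (α * x ^ (-α - 1))

theorem powerMeasure_lt_abs {α r : ℝ} (hα : 0 < α) (hr : 0 < r) :
    powerMeasure α {x | r < |x|} = ENNReal.ofReal (r ^ (-α)) := by
  have hms : MeasurableSet {x : ℝ | r < |x|} := measurableSet_lt measurable_const measurable_abs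
  have hset : {x : ℝ | r < |x|} ∩ Set.Ioi 0 = Set.Ioi r := by
    ext x
    simp only [Set.mem_inter_iff, Set.mem_ofPred_eq, Set.mem_Ioi]
    constructor
    · rintro ⟨h1, h2⟩
      rwa [abs_of_pos h2] at h1
    · intro h
      have h2 := hr.trans h
      exact ⟨by rwa [abs_of_pos h2], h2⟩
  have hlt : -α - 1 < -1 := by linarith
  rw [powerMeasure, withDensity_apply _ hms, Measure.restrict_restrict hms, hset,
    ← ofReal_integral_eq_lintegral_ofReal ((integrableOn_Ioi_rpow_of_lt hlt hr).const_mul α),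
    integral_const_mul, integral_Ioi_rpow_of_lt hlt hr]
  · congr 1
    rw [sub_add_cancel]
    field_simp
  · exact (ae_restrict_mem measurableSet_Ioi).mono fun x hx =>
      mul_nonneg hα.le (Real.rpow_nonneg (hr.trans hx).le _)

theorem absTail_powerMeasure {α r : ℝ} (hα : 0 < α) (hr : 0 < r) :
    absTail (powerMeasure α) r = r ^ (-α) := by
  rw [absTail, Measure.real, powerMeasure_lt_abs hα hr,
    ENNReal.toReal_ofReal (Real.rpow_nonneg hr.le _)]

theorem odds_constant_pos {a : ℝ} (ha : a ∈ Set.Ioo (0 : ℝ) 1) :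
    0 < π * a / Real.sin (π * a) :=
  div_pos (mul_pos pi_pos ha.1) <|
    Real.sin_pos_of_pos_of_lt_pi (mul_pos pi_pos ha.1) (by nlinarith [pi_pos, ha.2])

theorem lintegral_powerMeasure {α t : ℝ} (hα : α ∈ Set.Ioo (0 : ℝ) 2) (ht : 0 < t) :
    ∫⁻ x, ENNReal.ofReal (x ^ 2 / (x ^ 2 + t ^ 2)) ∂(powerMeasure α) =
      ENNReal.ofReal (t ^ (-α) * (π * (α / 2) / Real.sin (π * (α / 2)))) := by
  have ht' : 0 ≤ t ^ (-α) := Real.rpow_nonneg ht.le _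
  rw [lintegral_sq_div_add_sq _ ht, ENNReal.ofReal_mul ht',
    ← lintegral_odds_rpow_neg (a := α / 2) ⟨by linarith [hα.1], by linarith [hα.2]⟩,
    ← lintegral_const_mul' _ _ ENNReal.ofReal_ne_top]
  refine setLIntegral_congr_fun measurableSet_Ioo fun v hv => ?_
  have hv0 : 0 < v / (1 - v) := div_pos hv.1 (sub_pos.2 hv.2)
  rw [powerMeasure_lt_abs hα.1 (mul_pos ht (Real.sqrt_pos.2 hv0)), ← ENNReal.ofReal_mul ht',
    Real.mul_rpow ht.le (Real.sqrt_nonneg _), sqrt_rpow_neg hv0.le]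

theorem integrable_powerMeasure {α t : ℝ} (hα : α ∈ Set.Ioo (0 : ℝ) 2) (ht : 0 < t) :
    Integrable (fun x => x ^ 2 / (x ^ 2 + t ^ 2)) (powerMeasure α) := by
  refine ⟨(measurable_sq_div_add_sq t).aestronglyMeasurable, ?_⟩
  rw [hasFiniteIntegral_iff_ofReal (Eventually.of_forall fun x => sq_div_add_sq_nonneg x t),
    lintegral_powerMeasure hα ht]
  exact ENNReal.ofReal_lt_top

theorem stieltjesSq_powerMeasure {α t : ℝ} (hα : α ∈ Set.Ioo (0 : ℝ) 2) (ht : 0 < t) :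
    stieltjesSq (powerMeasure α) t = t ^ (-α) * (π * (α / 2) / Real.sin (π * (α / 2))) := by
  rw [stieltjesSq_eq_toReal, lintegral_powerMeasure hα ht, ENNReal.toReal_ofReal]
  exact mul_nonneg (Real.rpow_nonneg ht.le _)
    (odds_constant_pos ⟨by linarith [hα.1], by linarith [hα.2]⟩).le

theorem integrable_sq_div_add_sq (μ : Measure ℝ) [IsFiniteMeasure μ] (t : ℝ) :
    Integrable (fun x => x ^ 2 / (x ^ 2 + t ^ 2)) μ :=
  Integrable.of_bound (measurable_sq_div_add_sq t).aestronglyMeasurable 1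
    (Eventually.of_forall fun x => by
      rw [Real.norm_of_nonneg (sq_div_add_sq_nonneg x t)]
      exact sq_div_add_sq_le_one x t)

/-- If the transform is regularly varying, the normalised functionals converge to those of the
power measure. -/
theorem tendsto_ratioFunctional_div_stieltjesSq (μ : Measure ℝ) [IsFiniteMeasure μ] {α : ℝ}
    (hα : α ∈ Set.Ioo (0 : ℝ) 2) (hpos : ∀ᶠ t in atTop, 0 < stieltjesSq μ t)
    (h : ∀ l > 0, Tendsto (fun t => stieltjesSq μ (l * t) / stieltjesSq μ t) atTop
      (𝓝 (l ^ (-α)))) (f : C(I, ℝ)) :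
    Tendsto (fun t => ratioFunctional μ t (integrable_sq_div_add_sq μ t) f / stieltjesSq μ t) atTop
      (𝓝 (ratioFunctional (powerMeasure α) 1 (integrable_powerMeasure hα one_pos) f /
        (π * (α / 2) / Real.sin (π * (α / 2))))) := by
  have hC := odds_constant_pos (a := α / 2) ⟨by linarith [hα.1], by linarith [hα.2]⟩
  have hone : stieltjesSq (powerMeasure α) 1 = π * (α / 2) / Real.sin (π * (α / 2)) := by
    rw [stieltjesSq_powerMeasure hα one_pos, Real.one_rpow, one_mul]
  have hbound : ∀ (ν : Measure ℝ) (t : ℝ) (hν : Integrable (fun x => x ^ 2 / (x ^ 2 + t ^ 2)) ν),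
      0 < stieltjesSq ν t → ∀ f, |((stieltjesSq ν t)⁻¹ • ratioFunctional ν t hν) f| ≤ ‖f‖ := by
    intro ν t hν hp f
    rw [LinearMap.smul_apply, smul_eq_mul, abs_mul, abs_of_pos (inv_pos.2 hp), inv_mul_le_iff₀ hp]
    exact abs_ratioFunctional_le ν t hν f
  have hmain := tendsto_of_topologicalClosure_span_eq_top (l := atTop)
    (Λ := fun t => (stieltjesSq μ t)⁻¹ • ratioFunctional μ t (integrable_sq_div_add_sq μ t))
    (M := (stieltjesSq (powerMeasure α) 1)⁻¹ •
      ratioFunctional (powerMeasure α) 1 (integrable_powerMeasure hα one_pos))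
    (hpos.mono fun t ht => hbound _ _ _ ht) (hbound _ _ _ (hone ▸ hC))
    topologicalClosure_span_resolventMap ?_ f
  · simpa only [LinearMap.smul_apply, smul_eq_mul, inv_mul_eq_div, hone] using hmain
  · rintro _ ⟨k, rfl⟩
    have hk : 0 < √(1 + (k : ℝ)) := Real.sqrt_pos.2 (by positivity)
    simp only [LinearMap.smul_apply, smul_eq_mul, inv_mul_eq_div]
    rw [ratioFunctional_resolventMap _ one_pos, mul_one, stieltjesSq_powerMeasure hα hk, hone,
      mul_div_cancel_right₀ _ hC.ne']
    refine (h _ hk).congr' ((eventually_gt_atTop 0).mono fun t ht => ?_)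
    simp only [ratioFunctional_resolventMap _ ht]

/-- Tauberian direction: a regularly varying transform determines the asymptotics of the tail. -/
theorem tendsto_absTail_div_stieltjesSq (μ : Measure ℝ) [IsFiniteMeasure μ] {α : ℝ}
    (hα : α ∈ Set.Ioo (0 : ℝ) 2) (hpos : ∀ᶠ t in atTop, 0 < stieltjesSq μ t)
    (h : ∀ l > 0, Tendsto (fun t => stieltjesSq μ (l * t) / stieltjesSq μ t) atTop
      (𝓝 (l ^ (-α)))) :
    Tendsto (fun t => absTail μ t / stieltjesSq μ t) atTop
      (𝓝 (π * (α / 2) / Real.sin (π * (α / 2)))⁻¹) := by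
  have hC := odds_constant_pos (a := α / 2) ⟨by linarith [hα.1], by linarith [hα.2]⟩
  have hlim := tendsto_ratioFunctional_div_stieltjesSq μ hα hpos h
  set C := π * (α / 2) / Real.sin (π * (α / 2))
  have hsandwich : ∀ r > 1, ∃ f : C(I, ℝ),
      (∀ t > 0, absTail μ (r * t) ≤ ratioFunctional μ t (integrable_sq_div_add_sq μ t) f ∧
        ratioFunctional μ t (integrable_sq_div_add_sq μ t) f ≤ absTail μ t) ∧
      r ^ (-α) ≤ ratioFunctional (powerMeasure α) 1 (integrable_powerMeasure hα one_pos) f ∧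
      ratioFunctional (powerMeasure α) 1 (integrable_powerMeasure hα one_pos) f ≤ 1 := by
    intro r hr
    obtain ⟨f, hf⟩ := exists_absTail_le_ratioFunctional_le hr
    refine ⟨f, fun t ht => hf μ t ht (measure_ne_top _ _) _, ?_⟩
    have h1 := hf (powerMeasure α) 1 one_pos
      (by rw [powerMeasure_lt_abs hα.1 one_pos]; exact ENNReal.ofReal_ne_top)
      (integrable_powerMeasure hα one_pos)
    rwa [mul_one, absTail_powerMeasure hα.1 (by linarith), absTail_powerMeasure hα.1 one_pos,
      Real.one_rpow] at h1
  have hright : ∀ p : ℝ → Prop, (∀ᶠ r in 𝓝 1, p r) → ∃ r > 1, p r := by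
    intro p hp
    obtain ⟨r, hr1, hr2⟩ := ((eventually_nhdsWithin_of_eventually_nhds hp).and
      (self_mem_nhdsWithin (a := (1 : ℝ)) (s := Set.Ioi 1))).exists
    exact ⟨r, hr2, hr1⟩
  have hcont : ∀ s : ℝ, Tendsto (fun r : ℝ => r ^ s / C) (𝓝 1) (𝓝 C⁻¹) := by
    intro s
    have h1 := (Real.continuousAt_rpow_const 1 s (Or.inl one_ne_zero)).tendsto.div_const C
    rwa [Real.one_rpow, one_div] at h1
  refine tendsto_order.2 ⟨fun b hb => ?_, fun b hb => ?_⟩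
  · obtain ⟨r, hr, hrb⟩ := hright _ ((hcont (-α)).eventually (lt_mem_nhds hb))
    obtain ⟨f, hf, hf1, -⟩ := hsandwich r hr
    have hbf := hrb.trans_le (div_le_div_of_nonneg_right hf1 hC.le)
    filter_upwards [(hlim f).eventually (lt_mem_nhds hbf), hpos, eventually_gt_atTop 0]
      with t h1 h2 h3
    exact h1.trans_le (div_le_div_of_nonneg_right (hf t h3).2 h2.le)
  · obtain ⟨r, hr, hrb⟩ := hright _ ((hcont α).eventually (gt_mem_nhds hb))
    have hr0 : 0 < r := by linarith
    obtain ⟨f, hf, -, hf1⟩ := hsandwich r hr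
    have hrα : 0 < r ^ (-α) := Real.rpow_pos_of_pos hr0 _
    have hq := (hlim f).div (h r hr0) hrα.ne'
    have hbf : ratioFunctional (powerMeasure α) 1 (integrable_powerMeasure hα one_pos) f / C /
        r ^ (-α) < b := by
      refine lt_of_le_of_lt ?_ hrb
      rw [Real.rpow_neg hr0.le, div_inv_eq_mul, mul_comm, mul_div_assoc']
      exact div_le_div_of_nonneg_right
        (mul_le_of_le_one_right (Real.rpow_nonneg hr0.le _) hf1) hC.le
    have hscale : Tendsto (fun t : ℝ => r * t) atTop atTop := tendsto_id.const_mul_atTop hr0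
    have hev : ∀ᶠ t in atTop, absTail μ (r * t) / stieltjesSq μ (r * t) < b := by
      filter_upwards [hq.eventually (gt_mem_nhds hbf), hpos, hscale.eventually hpos,
        eventually_gt_atTop 0] with t h1 h2 h3 h4
      refine lt_of_le_of_lt ?_ h1
      simp only [Pi.div_apply]
      rw [div_div_div_cancel_right₀ h2.ne']
      exact div_le_div_of_nonneg_right (hf t h4).1 h3.le
    have hinv : Tendsto (fun t : ℝ => r⁻¹ * t) atTop atTop :=
      tendsto_id.const_mul_atTop (inv_pos.2 hr0)
    filter_upwards [hinv.eventually hev] with t h1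
    rwa [mul_inv_cancel_left₀ hr0.ne'] at h1

theorem absTail_eq_two_mul_of_map_neg {μ : Measure ℝ} [IsFiniteMeasure μ]
    (hsym : μ.map (fun x => -x) = μ) {t : ℝ} (ht : 0 ≤ t) :
    absTail μ t = 2 * (μ (Set.Ioi t)).toReal := by
  have hset : {x : ℝ | t < |x|} = Set.Ioi t ∪ (fun x => -x) ⁻¹' Set.Ioi t := by
    ext x
    simp only [Set.mem_ofPred_eq, lt_abs, Set.mem_union, Set.mem_preimage, Set.mem_Ioi]
  have hdisj : Disjoint (Set.Ioi t) ((fun x => -x) ⁻¹' Set.Ioi t) :=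
    Set.disjoint_left.2 fun x hx hx' => by
      simp only [Set.mem_preimage, Set.mem_Ioi] at hx hx'
      linarith
  have hneg : μ ((fun x => -x) ⁻¹' Set.Ioi t) = μ (Set.Ioi t) := by
    rw [← Measure.map_apply measurable_neg measurableSet_Ioi, hsym]
  rw [absTail, hset, measureReal_union hdisj (measurable_neg measurableSet_Ioi), Measure.real,
    Measure.real, hneg, two_mul]

/-- Tauberian theorem for a symmetric probability measure `μ` on `ℝ` and `α ∈ (0,2)`:
`μ((t,∞)) ~ L(t)/(2 t^α)` iff `-ψ_μ(-1/(i t)) = -ψ_μ(i/t) ~ ((πα/2)/sin(πα/2)) · L(t)/t^α`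
as `t → +∞`; here `ψ_μ(i/t)` is real-valued by the symmetry of `μ` (we take real parts). -/
theorem tauberian_symmetric
    (μ : Measure ℝ) [IsProbabilityMeasure μ] (hsym : μ.map (fun x => -x) = μ)
    (L : ℝ → ℝ) (hLpos : ∀ t : ℝ, 0 < t → 0 < L t) (hL : SlowlyVarying L)
    (α : ℝ) (hα : α ∈ Set.Ioo (0 : ℝ) 2) :
    Tendsto (fun t : ℝ => (μ (Set.Ioi t)).toReal / (L t / (2 * t ^ α))) atTop (𝓝 1) ↔
      Tendsto (fun t : ℝ =>
        (-(psiC μ (Complex.I / (t : ℂ)))).re /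
          ((π * α / 2 / Real.sin (π * α / 2)) * (L t / t ^ α)))
        atTop (𝓝 1) := by
  have hC := odds_constant_pos (a := α / 2) ⟨by linarith [hα.1], by linarith [hα.2]⟩
  rw [show π * α / 2 = π * (α / 2) by ring]
  set C := π * (α / 2) / Real.sin (π * (α / 2))
  have hH : ∀ t : ℝ, 0 < t → 0 < L t / t ^ α := fun t ht =>
    div_pos (hLpos t ht) (Real.rpow_pos_of_pos ht α)
  have htail : (fun t : ℝ => (μ (Set.Ioi t)).toReal / (L t / (2 * t ^ α))) =ᶠ[atTop]
      fun t => absTail μ t / (L t / t ^ α) := by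
    filter_upwards [eventually_gt_atTop 0] with t ht
    rw [absTail_eq_two_mul_of_map_neg hsym ht.le, mul_comm 2 (t ^ α), ← div_div (L t),
      div_div_eq_mul_div, mul_comm 2]
  have htrans : (fun t : ℝ => (-(psiC μ (Complex.I / (t : ℂ)))).re / (C * (L t / t ^ α)))
      =ᶠ[atTop] fun t => stieltjesSq μ t / (C * (L t / t ^ α)) := by
    filter_upwards [eventually_gt_atTop 0] with t ht
    rw [re_neg_psiC μ ht]
  rw [tendsto_congr' htail, tendsto_congr' htrans]
  constructor
  · intro h
    have hpos : ∀ t, 0 < absTail μ t := by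
      intro t
      obtain ⟨s, hs1, hs2⟩ := ((h.eventually_ne one_ne_zero).and (eventually_ge_atTop t)).exists
      refine lt_of_lt_of_le ?_ (antitone_absTail μ hs2)
      exact lt_of_le_of_ne measureReal_nonneg fun h0 => hs1 (by rw [← h0, zero_div])
    have h1 := tendsto_stieltjesSq_div_absTail μ hα hpos fun l hl =>
      tendsto_comp_mul_div_of_slowlyVarying hLpos hL h one_ne_zero hl
    have h2 := (h1.mul h).div_const C
    rw [mul_one, div_self hC.ne'] at h2
    refine h2.congr' ((eventually_gt_atTop 0).mono fun t ht => ?_)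
    simp only [div_mul_div_cancel₀ (hpos t).ne', div_div, mul_comm C]
  · intro h
    have h' : Tendsto (fun t => stieltjesSq μ t / (L t / t ^ α)) atTop (𝓝 C) := by
      have h1 := h.const_mul C
      rw [mul_one] at h1
      refine h1.congr fun t => ?_
      rw [← div_div, div_right_comm, mul_div_cancel₀ _ hC.ne']
    have hpos : ∀ᶠ t in atTop, 0 < stieltjesSq μ t := by
      filter_upwards [h'.eventually (lt_mem_nhds hC), eventually_gt_atTop 0] with t h1 h2
      exact (div_pos_iff_of_pos_right (hH t h2)).1 h1
    have h1 := tendsto_absTail_div_stieltjesSq μ hα hpos fun l hl =>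
      tendsto_comp_mul_div_of_slowlyVarying hLpos hL h' hC.ne' hl
    have h2 := h1.mul h'
    rw [inv_mul_cancel₀ hC.ne'] at h2
    refine h2.congr' (hpos.mono fun t ht => ?_)
    rw [div_mul_div_cancel₀ ht.ne']
end
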